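/- Let (𝔊,Φ) be a structurally compatible right-permutative Ψ-associative cellular automaton of radius 1 on a topological Markov chain 𝔊. Suppose there is a 1-block topological conjugacy, induced by a bijection of letters, between (𝔊,Φ) and (𝔎 × 𝔅, Φ_𝔎 × g_𝔅), where 𝔎 and 𝔅 are topological Markov chains, Φ_𝔎 is a group c.a. on 𝔎 with abelian group operation, g_𝔅 is a translation on 𝔅, and the SC bipermutative c.a. (𝔎, Φ_𝔎) is regular and simple. Then for every shift-invariant probability measure μ on 𝔊 with complete connections (compatible with 𝔊) and summable decay, the Cesàro mean distribution (1/N) ∑_{n=0}^{N−1} μ ∘ Φ^{−n} converges in the weak-* topology. -/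

import Mathlib

open Filter Topology MeasureTheory
open scoped ENNReal

namespace CAStmt

/-- The shift map on bi-infinite sequences. -/
def shiftMap {G : Type*} (x : ℤ → G) : ℤ → G := fun n => x (n + 1)

/-- The topological Markov chain determined by the transition set `E`. -/
def TMC {G : Type*} (E : Set (G × G)) : Set (ℤ → G) := {x | ∀ i : ℤ, (x i, x (i + 1)) ∈ E}

/-- The word `w` occurs in some point of `X`. -/
def WordIn {G : Type*} (X : Set (ℤ → G)) {m : ℕ} (w : Fin m → G) : Prop :=
  ∃ x ∈ X, ∃ j : ℤ, ∀ i : Fin m, x (j + ((i : ℕ) : ℤ)) = w i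

/-- Every letter of the alphabet occurs in some point of the TMC. -/
def EveryLetterOccurs {G : Type*} (E : Set (G × G)) : Prop :=
  ∀ g : G, ∃ x ∈ TMC E, ∃ i : ℤ, x i = g

/-- The radius-1 cellular automaton map with local rule `φ`. -/
def CA {G : Type*} (φ : G → G → G) (x : ℤ → G) : ℤ → G := fun j => φ (x j) (x (j + 1))

/-- Structural compatibility of the local rule `φ` with the TMC of `E`. -/
def SC {G : Type*} (E : Set (G × G)) (φ : G → G → G) : Prop :=
  ∀ x ∈ TMC E, ∀ y ∈ TMC E, (fun i => φ (x i) (y i)) ∈ TMC E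

def RightPerm {G : Type*} (φ : G → G → G) : Prop := ∀ a, Function.Bijective (φ a)

def LeftPerm {G : Type*} (φ : G → G → G) : Prop := ∀ b, Function.Bijective (fun a => φ a b)

/-- Irreducibility: any two letters are joined by an allowed word `(u,v₁,…,v_k,w)`, `k ≥ 1`. -/
def IrreducibleTMC {G : Type*} (E : Set (G × G)) : Prop :=
  ∀ u w : G, ∃ x ∈ TMC E, ∃ i j : ℤ, i + 1 < j ∧ x i = u ∧ x j = w

/-- Mixing with mixing constant `q`. -/
def MixingTMCWith {G : Type*} (E : Set (G × G)) (q : ℕ) : Prop :=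
  1 ≤ q ∧ ∀ k : ℕ, q ≤ k → ∀ u w : G,
    ∃ x ∈ TMC E, ∃ i : ℤ, x i = u ∧ x (i + (k : ℤ) + 1) = w

def MixingTMC {G : Type*} (E : Set (G × G)) : Prop := ∃ q, MixingTMCWith E q

/-- `Φ` is `N`-scaling on `X`: `(Φ^N x)₀ = φ(x₀, x_N)`. -/
def NScalingOn {G : Type*} (X : Set (ℤ → G)) (φ : G → G → G) (N : ℕ) : Prop :=
  ∀ x ∈ X, (CA φ)^[N] x 0 = φ (x 0) (x (N : ℤ))

/-- The TMC `𝔥(𝔽,τ,n)` over the alphabet `F × Fin n`. -/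
def hTMC {F : Type*} (τ : Equiv.Perm F) (n : ℕ) : Set (ℤ → F × Fin n) :=
  TMC {p : (F × Fin n) × (F × Fin n) | p.2.1 = τ p.1.1}

/-- `op` is a `k`-block operation (memory 0, anticipation `k-1`) closed on `Λ`. -/
def KBlockOp {A : Type*} (Λ : Set (ℤ → A)) (k : ℕ)
    (op : (ℤ → A) → (ℤ → A) → (ℤ → A)) : Prop :=
  (∀ x ∈ Λ, ∀ y ∈ Λ, op x y ∈ Λ) ∧
  ∃ ρ : (Fin k → A) → (Fin k → A) → A,
    ∀ x ∈ Λ, ∀ y ∈ Λ, ∀ j : ℤ,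
      op x y j = ρ (fun i => x (j + ((i : ℕ) : ℤ))) (fun i => y (j + ((i : ℕ) : ℤ)))

/-- `op` is a quasigroup operation on `Λ`: all translations are bijections of `Λ`. -/
def QuasigroupOp {A : Type*} (Λ : Set (ℤ → A)) (op : (ℤ → A) → (ℤ → A) → (ℤ → A)) : Prop :=
  ∀ z ∈ Λ, Set.BijOn (fun x => op x z) Λ Λ ∧ Set.BijOn (fun y => op z y) Λ Λ

/-- A 1-block topological conjugacy between `(X,Φ)` and `(Y,Ψ)` induced by the letter map `θ`. -/
def OneBlockConjugacy {A B : Type*} (X : Set (ℤ → A)) (Φ : (ℤ → A) → (ℤ → A))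
    (Y : Set (ℤ → B)) (Ψ : (ℤ → B) → (ℤ → B)) (θ : A → B) : Prop :=
  Set.BijOn (fun x => θ ∘ x) X Y ∧ ∀ x ∈ X, θ ∘ (Φ x) = Ψ (θ ∘ x)

/-- `add` is an abelian group operation. -/
def IsAbelianGroupOp {K : Type*} (add : K → K → K) : Prop :=
  (∀ a b c, add (add a b) c = add a (add b c)) ∧ (∀ a b, add a b = add b a) ∧
  ∃ z : K, (∀ a, add z a = a) ∧ ∀ a, ∃ b, add a b = z

/-- The product transition set on `K × B`. -/
def prodE {K B : Type*} (EK : Set (K × K)) (EB : Set (B × B)) : Set ((K × B) × (K × B)) :=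
  {p | (p.1.1, p.2.1) ∈ EK ∧ (p.1.2, p.2.2) ∈ EB}

/-- `φK` is an affine local rule for the abelian group operation `add`. -/
def IsAffineRuleExpl {K : Type*} (add : K → K → K) (φK : K → K → K) : Prop :=
  IsAbelianGroupOp add ∧
  ∃ (η ρc : K → K) (c : K), Function.Bijective η ∧ Function.Bijective ρc ∧
    (∀ a b, η (add a b) = add (η a) (η b)) ∧ (∀ a b, ρc (add a b) = add (ρc a) (ρc b)) ∧
    (∀ a, η (ρc a) = ρc (η a)) ∧
    ∀ a b, φK a b = add (add (η a) (ρc b)) c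

/-- The cylinder on the word `w` at coordinates `0,…,m-1`. -/
def cyl {A : Type*} {m : ℕ} (w : Fin m → A) : Set (ℤ → A) :=
  {x | ∀ i : Fin m, x ((i : ℕ) : ℤ) = w i}

/-- A past: `p i` is the letter at coordinate `-(i+1)`; all transitions allowed. -/
def IsPast {A : Type*} (E : Set (A × A)) (p : ℕ → A) : Prop :=
  ∀ i : ℕ, (p (i + 1), p i) ∈ E

/-- The word `(w_{-m},…,w_{-1})` of the past `p`. -/
def pastWord {A : Type*} (p : ℕ → A) (m : ℕ) : Fin m → A :=
  fun j => p (m - 1 - (j : ℕ))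

/-- `μ` has complete connections (compatible with the TMC of `E`) and summable decay. -/
def CCSD {A : Type*} [MeasurableSpace A] (E : Set (A × A)) (μ : Measure (ℤ → A)) : Prop :=
  ∃ ν : (ℕ → A) → A → ℝ,
    (∀ p, IsPast E p → ∀ a, (p 0, a) ∈ E →
      0 < ν p a ∧
      Tendsto (fun m : ℕ =>
          (μ (cyl (Fin.snoc (pastWord p m) a))).toReal / (μ (cyl (pastWord p m))).toReal)
        atTop (nhds (ν p a))) ∧
    ∃ γ : ℕ → ℝ, Summable γ ∧
      ∀ m : ℕ, 1 ≤ m → ∀ p q, IsPast E p → IsPast E q → (∀ i < m, p i = q i) →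
        ∀ a, (p 0, a) ∈ E → |ν p a / ν q a - 1| ≤ γ m

/-- A shift-invariant probability measure carried by the TMC of `E`, positive on allowed
cylinders. -/
def GoodMeasure {A : Type*} [MeasurableSpace A] (E : Set (A × A)) (μ : Measure (ℤ → A)) : Prop :=
  IsProbabilityMeasure μ ∧ Measure.map shiftMap μ = μ ∧ μ (TMC E) = 1 ∧
  ∀ (m : ℕ) (w : Fin m → A), WordIn (TMC E) w → 0 < μ (cyl w)

/-- The identification of `𝔽 × Σ_n` with `𝔥(𝔽,τ,n)`. -/
def ident {F : Type*} (τ : Equiv.Perm F) {n : ℕ} (f : F) (y : ℤ → Fin n) : ℤ → F × Fin n :=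
  fun i => ((τ ^ i) f, y i)

/-- A quasigroup operation on an alphabet. -/
def QuasigroupPointOp {K : Type*} (o : K → K → K) : Prop :=
  ∀ a, Function.Bijective (fun x => o x a) ∧ Function.Bijective (o a)

/-- The data witnessing that an SC bipermutative c.a. is regular and simple. -/
def RegularSimpleData {K F : Type*} (EK : Set (K × K)) (φK : K → K → K)
    (τ : Equiv.Perm F) (n k : ℕ)
    (op : (ℤ → F × Fin n) → (ℤ → F × Fin n) → (ℤ → F × Fin n))
    (θ : K → F × Fin n) (oF : F → F → F) (oS : Fin n → Fin n → Fin n) : Prop :=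
  1 ≤ n ∧ 1 ≤ k ∧
  KBlockOp (hTMC τ n) k op ∧ QuasigroupOp (hTMC τ n) op ∧
  OneBlockConjugacy (TMC EK) (CA φK) (hTMC τ n) (fun x => op x (shiftMap x)) θ ∧
  QuasigroupPointOp oF ∧ QuasigroupPointOp oS ∧
  ∀ (f g : F) (y z : ℤ → Fin n),
    op (ident τ f y) (ident τ g z) = ident τ (oF f g) (fun i => oS (y i) (z i))

/-- An SC bipermutative c.a. is regular and simple. -/
def RegularSimple {K : Type*} (EK : Set (K × K)) (φK : K → K → K) : Prop :=
  ∃ (F : Type) (_ : Fintype F) (τ : Equiv.Perm F) (n k : ℕ)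
    (op : (ℤ → F × Fin n) → (ℤ → F × Fin n) → (ℤ → F × Fin n))
    (θ : K → F × Fin n) (oF : F → F → F) (oS : Fin n → Fin n → Fin n),
    RegularSimpleData EK φK τ n k op θ oF oS

/-- Weak-* convergence of the Cesàro means of `μ` under `Φ` to `κ`. -/
def CesaroTendstoTo {G : Type*} [TopologicalSpace G] [MeasurableSpace G]
    (μ : Measure (ℤ → G)) (Φ : (ℤ → G) → (ℤ → G)) (κ : Measure (ℤ → G)) : Prop :=
  ∀ f : C(ℤ → G, ℝ), Tendsto
    (fun N : ℕ => (N : ℝ)⁻¹ * ∑ n ∈ Finset.range N, ∫ x, f (Φ^[n] x) ∂μ)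
    atTop (nhds (∫ x, f x ∂κ))

/-- `κ` is the Parry measure of the irreducible TMC of `E`. -/
def IsParryMeasure {G : Type*} [Fintype G] [MeasurableSpace G] (E : Set (G × G))
    (κ : Measure (ℤ → G)) : Prop :=
  IsProbabilityMeasure κ ∧ Measure.map shiftMap κ = κ ∧
  ∃ (lam : ℝ) (r l : G → ℝ), 0 < lam ∧ (∀ a, 0 < r a) ∧ (∀ a, 0 < l a) ∧
    (∀ a : G, (∑ b : G, E.indicator (fun _ => r b) (a, b)) = lam * r a) ∧
    (∀ b : G, (∑ a : G, E.indicator (fun _ => l a) (a, b)) = lam * l b) ∧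
    (∑ a : G, l a * r a) = 1 ∧
    ∀ (m : ℕ) (w : Fin (m + 1) → G), WordIn (TMC E) w →
      (κ (cyl w)).toReal = l (w 0) * r (w (Fin.last m)) / lam ^ m

/-- Entropy of the refinement `P ∨ T⁻¹P ∨ ⋯ ∨ T^{-(n-1)}P`. -/
noncomputable def joinEntropy {X : Type*} [MeasurableSpace X] (μ : Measure X) (T : X → X)
    {r : ℕ} (P : Fin r → Set X) (n : ℕ) : ℝ :=
  -∑ c : Fin n → Fin r,
      ((μ (⋂ i : Fin n, T^[(i : ℕ)] ⁻¹' P (c i))).toReal *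
        Real.log (μ (⋂ i : Fin n, T^[(i : ℕ)] ⁻¹' P (c i))).toReal)

/-- The Kolmogorov–Sinai entropy `h_μ(T)` is positive: some finite measurable partition has
positive entropy. -/
def KSEntropyPos {X : Type*} [MeasurableSpace X] (μ : Measure X) (T : X → X) : Prop :=
  ∃ (r : ℕ) (P : Fin r → Set X), (∀ i, MeasurableSet (P i)) ∧
    Pairwise (Function.onFun Disjoint P) ∧ (⋃ i, P i) = Set.univ ∧
    0 < Filter.liminf (fun n : ℕ => joinEntropy μ T P n / n) Filter.atTop

end CAStmt

namespace CAStmt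

/-- The upper asymptotic density of `X` is at most `c`. -/
def UpperDensityLE (X : Set ℕ) (c : ℝ) : Prop :=
  ∀ ε > 0, ∀ᶠ N : ℕ in atTop, ((Set.Iio N ∩ X).ncard : ℝ) ≤ (c + ε) * N

namespace UpperDensityLE

lemma mono {X Y : Set ℕ} {c d : ℝ} (h : UpperDensityLE Y d) (hXY : X ⊆ Y) (hcd : d ≤ c) :
    UpperDensityLE X c := by
  intro ε hε
  filter_upwards [h ε hε] with N hN
  have h1 : (Set.Iio N ∩ X).ncard ≤ (Set.Iio N ∩ Y).ncard :=
    Set.ncard_le_ncard (Set.inter_subset_inter_right _ hXY) ((Set.finite_Iio N).inter_of_left _)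
  calc ((Set.Iio N ∩ X).ncard : ℝ) ≤ (Set.Iio N ∩ Y).ncard := by exact_mod_cast h1
    _ ≤ (d + ε) * N := hN
    _ ≤ (c + ε) * N := by gcongr

lemma of_forall_pos {X : Set ℕ} {c : ℝ} (h : ∀ ε > 0, UpperDensityLE X (c + ε)) :
    UpperDensityLE X c := by
  intro ε hε
  filter_upwards [h (ε / 2) (by positivity) (ε / 2) (by positivity)] with N hN
  linarith

lemma univ (X : Set ℕ) : UpperDensityLE X 1 := by
  intro ε hε
  filter_upwards with N
  have h1 : (Set.Iio N ∩ X).ncard ≤ (Set.Iio N).ncard :=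
    Set.ncard_le_ncard Set.inter_subset_left (Set.finite_Iio N)
  have h2 : (Set.Iio N).ncard = N := by simp [Set.ncard_eq_toFinset_card']
  rw [h2] at h1
  calc ((Set.Iio N ∩ X).ncard : ℝ) ≤ N := by exact_mod_cast h1
    _ ≤ (1 + ε) * N := by nlinarith [Nat.cast_nonneg (α := ℝ) N]

lemma empty : UpperDensityLE ∅ 0 := by
  intro ε hε
  filter_upwards with N
  simp
  positivity

lemma union {X Y : Set ℕ} {c d : ℝ} (hX : UpperDensityLE X c) (hY : UpperDensityLE Y d) :
    UpperDensityLE (X ∪ Y) (c + d) := by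
  intro ε hε
  filter_upwards [hX (ε / 2) (by positivity), hY (ε / 2) (by positivity)] with N h1 h2
  have h3 : (Set.Iio N ∩ (X ∪ Y)).ncard ≤ (Set.Iio N ∩ X).ncard + (Set.Iio N ∩ Y).ncard := by
    rw [Set.inter_union_distrib_left]
    exact Set.ncard_union_le _ _
  have h4 : ((Set.Iio N ∩ (X ∪ Y)).ncard : ℝ) ≤
      (Set.Iio N ∩ X).ncard + (Set.Iio N ∩ Y).ncard := by exact_mod_cast h3
  linarith

lemma biUnion {ι : Type*} (s : Finset ι) {X : ι → Set ℕ} {c : ι → ℝ}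
    (h : ∀ i ∈ s, UpperDensityLE (X i) (c i)) :
    UpperDensityLE (⋃ i ∈ s, X i) (∑ i ∈ s, c i) := by
  classical
  induction s using Finset.induction_on with
  | empty => simpa using empty
  | insert a s ha ih =>
    rw [Finset.set_biUnion_insert, Finset.sum_insert ha]
    exact (h a (by simp)).union (ih fun i hi => h i (by simp [hi]))

lemma residueClass {X : Set ℕ} {c : ℝ} (h : UpperDensityLE X c) {q : ℕ} (hq : 0 < q) (r : ℕ) :
    UpperDensityLE {n | n % q = r ∧ n / q ∈ X} (c / q) := by
  intro ε hε
  have hq' : (0 : ℝ) < q := by exact_mod_cast hq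
  have hc : Tendsto (fun N : ℕ => N / q + 1) atTop atTop :=
    (tendsto_add_atTop_nat 1).comp (Nat.tendsto_div_const_atTop hq.ne')
  have hev := hc.eventually (h (q * ε / 2) (by positivity))
  have hbig : ∀ᶠ N : ℕ in atTop, |c + q * ε / 2| ≤ ε / 2 * N :=
    (tendsto_natCast_atTop_atTop.const_mul_atTop (by positivity)).eventually_ge_atTop _
  filter_upwards [hev, hbig] with N h1 h2
  have h3 : (Set.Iio N ∩ {n | n % q = r ∧ n / q ∈ X}).ncard ≤
      (Set.Iio (N / q + 1) ∩ X).ncard := by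
    refine Set.ncard_le_ncard_of_injOn (fun n => n / q) ?_ ?_
      ((Set.finite_Iio _).inter_of_left _)
    · rintro n ⟨hn, hn2, hn3⟩
      refine ⟨?_, hn3⟩
      simp only [Set.mem_Iio] at hn ⊢
      exact Nat.lt_succ_of_le (Nat.div_le_div_right hn.le)
    · rintro n ⟨-, hn2, -⟩ m ⟨-, hm2, -⟩ hnm
      simp only at hnm
      rw [← Nat.div_add_mod n q, ← Nat.div_add_mod m q, hnm, hn2, hm2]
  have h4 : ((Set.Iio N ∩ {n | n % q = r ∧ n / q ∈ X}).ncard : ℝ) ≤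
      (Set.Iio (N / q + 1) ∩ X).ncard := by exact_mod_cast h3
  have hc0 : (0 : ℝ) ≤ ((Set.Iio (N / q + 1) ∩ X).ncard : ℝ) := by positivity
  have h5 : ((N / q + 1 : ℕ) : ℝ) ≤ N / q + 1 := by
    push_cast
    gcongr
    exact Nat.cast_div_le
  have h6 : 0 ≤ c + q * ε / 2 := by
    by_contra hneg
    push Not at hneg
    have : (c + q * ε / 2) * ((N / q + 1 : ℕ) : ℝ) < 0 :=
      mul_neg_of_neg_of_pos hneg (by positivity)
    linarith
  calc _ ≤ _ := h4
    _ ≤ (c + q * ε / 2) * ((N / q + 1 : ℕ) : ℝ) := h1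
    _ ≤ (c + q * ε / 2) * (N / q + 1) := by gcongr
    _ = (c / q + ε / 2) * N + (c + q * ε / 2) := by field_simp
    _ ≤ (c / q + ε / 2) * N + ε / 2 * N := by
        gcongr
        exact (le_abs_self _).trans h2
    _ = (c / q + ε) * N := by ring

end UpperDensityLE

open Polynomial in
/-- The polynomial whose coefficients are those of `f` in the degrees congruent to `r` mod `q`. -/
noncomputable def polySection {R : Type*} [CommSemiring R] (q r : ℕ) (f : R[X]) : R[X] :=
  contract q (divX^[r] f)

open Polynomial in
lemma coeff_polySection {R : Type*} [CommSemiring R] {q : ℕ} (hq : q ≠ 0) (r : ℕ) (f : R[X])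
    (i : ℕ) : (polySection q r f).coeff i = f.coeff (i * q + r) := by
  rw [polySection, coeff_contract hq]
  induction r generalizing f with
  | zero => rfl
  | succ r ih => rw [Function.iterate_succ_apply, ih, coeff_divX, add_assoc]

open Polynomial in
lemma polySection_expand_mul {R : Type*} [CommSemiring R] {q r : ℕ} (hr : r < q) (P f : R[X]) :
    polySection q r (expand R q P * f) = P * polySection q r f := by
  have hq : q ≠ 0 := by omega
  have hadd : ∀ g h : R[X], polySection q r (g + h) = polySection q r g + polySection q r h := by
    intro g h
    ext i
    simp [coeff_polySection hq]
  induction P using Polynomial.induction_on' with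
  | add g h hg hh => rw [map_add, add_mul, hadd, hg, hh, add_mul]
  | monomial j a =>
    ext i
    rw [coeff_polySection hq, expand_monomial, ← C_mul_X_pow_eq_monomial,
      ← C_mul_X_pow_eq_monomial, mul_assoc, mul_assoc, coeff_C_mul, coeff_C_mul, coeff_X_pow_mul',
      coeff_X_pow_mul', coeff_polySection hq]
    have hiff : j * q ≤ i * q + r ↔ j ≤ i := by
      constructor
      · intro h
        by_contra hlt
        push Not at hlt
        have := Nat.mul_le_mul_right q (Nat.succ_le_of_lt hlt)
        rw [Nat.succ_mul] at this
        omega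
      · intro h
        have := Nat.mul_le_mul_right q h
        omega
    by_cases h : j ≤ i
    · rw [if_pos (hiff.2 h), if_pos h, Nat.sub_mul]
      congr 2
      have := Nat.mul_le_mul_right q h
      omega
    · rw [if_neg (fun h' => h (hiff.1 h')), if_neg h]

open Polynomial in
lemma card_support_polySection_le {R : Type*} [CommSemiring R] {q : ℕ} (hq : q ≠ 0) (r : ℕ)
    (f : R[X]) : (polySection q r f).support.card ≤ f.support.card := by
  refine Finset.card_le_card_of_injOn (fun i => i * q + r) ?_ ?_
  · intro i hi
    simpa [coeff_polySection hq] using hi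
  · intro i _ j _ hij
    simpa [hq] using hij

open Polynomial in
lemma card_support_polySection_add_le {R : Type*} [CommSemiring R] {q r r' : ℕ} (hr : r < q)
    (hr' : r' < q) (hne : r ≠ r') (f : R[X]) :
    (polySection q r f).support.card + (polySection q r' f).support.card ≤ f.support.card := by
  classical
  have hq : q ≠ 0 := by omega
  have hinj : ∀ s, Function.Injective (fun i => i * q + s) := by
    intro s i j hij
    simpa [hq] using hij
  rw [← Finset.card_image_of_injective (polySection q r f).support (hinj r),
    ← Finset.card_image_of_injective (polySection q r' f).support (hinj r'),
    ← Finset.card_union_of_disjoint]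
  · have hsub : ∀ s, (polySection q s f).support.image (fun i => i * q + s) ⊆ f.support := by
      intro s i hi
      obtain ⟨j, hj, rfl⟩ := Finset.mem_image.1 hi
      rwa [mem_support_iff, coeff_polySection hq, ← mem_support_iff] at hj
    exact Finset.card_le_card (Finset.union_subset (hsub r) (hsub r'))
  · rw [Finset.disjoint_left]
    rintro i hi hi'
    obtain ⟨j, -, rfl⟩ := Finset.mem_image.1 hi
    obtain ⟨j', -, h⟩ := Finset.mem_image.1 hi'
    have h1 : (j' * q + r') % q = r' := by rw [Nat.mul_add_mod', Nat.mod_eq_of_lt hr']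
    have h2 : (j * q + r) % q = r := by rw [Nat.mul_add_mod', Nat.mod_eq_of_lt hr]
    rw [h] at h1
    exact hne (h2.symm.trans h1)

open Polynomial in
lemma polySection_X_add_one_pow_mul {p : ℕ} [Fact p.Prime] (k n : ℕ) {r : ℕ} (hr : r < p ^ k)
    (A : (ZMod p)[X]) :
    polySection (p ^ k) r ((X + 1) ^ n * A) =
      (X + 1) ^ (n / p ^ k) * polySection (p ^ k) r ((X + 1) ^ (n % p ^ k) * A) := by
  have hexp : ∀ f : (ZMod p)[X], expand (ZMod p) (p ^ k) f = f ^ p ^ k := by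
    intro f
    clear hr
    induction k generalizing f with
    | zero => simp
    | succ k ih => rw [pow_succ, ← expand_expand, ZMod.expand_card, ih, ← pow_mul, mul_comm]
  rw [← polySection_expand_mul hr, hexp, ← mul_assoc, ← pow_mul, ← pow_add,
    mul_comm (n / p ^ k), Nat.div_add_mod]

open Polynomial in
/-- For almost all `n` the power `(X + 1) ^ n` has many nonzero coefficients. -/
lemma upperDensityLE_card_support_X_add_one_pow (p : ℕ) [Fact p.Prime] (m : ℕ) :
    UpperDensityLE {n | ((X + 1 : (ZMod p)[X]) ^ n).support.card < m} 0 := by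
  have hp : 1 < p := (Fact.out : p.Prime).one_lt
  induction m with
  | zero => simpa using UpperDensityLE.empty
  | succ m ih =>
    refine UpperDensityLE.of_forall_pos fun ε hε => ?_
    obtain ⟨k, hk⟩ := exists_pow_lt_of_lt_one hε (inv_lt_one_of_one_lt₀ (by exact_mod_cast hp :
      (1 : ℝ) < p))
    have hq : 0 < p ^ k := by positivity
    have hfin : UpperDensityLE ({n | n % p ^ k = 0 ∧ n / p ^ k ∈ Set.univ} ∪
        ⋃ r ∈ Finset.range (p ^ k), {n | n % p ^ k = r ∧ n / p ^ k ∈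
          {n | ((X + 1 : (ZMod p)[X]) ^ n).support.card < m}})
        (1 / (p ^ k : ℕ) + ∑ r ∈ Finset.range (p ^ k), 0 / ((p ^ k : ℕ) : ℝ)) :=
      ((UpperDensityLE.univ _).residueClass hq 0).union
        (UpperDensityLE.biUnion _ fun r _ => ih.residueClass hq r)
    refine hfin.mono ?_ ?_
    · intro n hn
      by_cases h0 : n % p ^ k = 0
      · exact Or.inl ⟨h0, trivial⟩
      refine Or.inr ?_
      simp only [Set.mem_iUnion]
      have hlt : n % p ^ k < p ^ k := Nat.mod_lt _ hq
      refine ⟨n % p ^ k, Finset.mem_range.2 hlt, rfl, ?_⟩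
      have hsec : ∀ r, r = 0 ∨ r = n % p ^ k →
          polySection (p ^ k) r ((X + 1 : (ZMod p)[X]) ^ n) = (X + 1) ^ (n / p ^ k) := by
        intro r hr
        have hr' : r < p ^ k := by rcases hr with rfl | rfl <;> omega
        have h1 := polySection_X_add_one_pow_mul k n hr' (1 : (ZMod p)[X])
        rw [mul_one, mul_one] at h1
        rw [h1]
        convert mul_one _
        ext i
        rw [coeff_polySection hq.ne', coeff_X_add_one_pow, coeff_one]
        rcases Nat.eq_zero_or_pos i with rfl | hi
        · rcases hr with rfl | rfl <;> simp
        · rw [Nat.choose_eq_zero_of_lt, if_neg hi.ne']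
          · simp
          · nlinarith
      have h2 := card_support_polySection_add_le hq hlt (Ne.symm h0) ((X + 1 : (ZMod p)[X]) ^ n)
      rw [hsec 0 (Or.inl rfl), hsec _ (Or.inr rfl)] at h2
      have h3 : 0 < ((X + 1 : (ZMod p)[X]) ^ (n / p ^ k)).support.card := by
        rw [Finset.card_pos, Polynomial.support_nonempty]
        exact pow_ne_zero _ (X_add_C_ne_zero 1)
      simp only [Set.mem_ofPred_eq] at hn ⊢
      omega
    · rw [inv_pow] at hk
      simp
      exact hk.le

open Polynomial in
/-- For nonzero `A` and almost all `n`, the product `(X + 1) ^ n * A` has many nonzero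
coefficients. -/
lemma upperDensityLE_card_support_X_add_one_pow_mul (p : ℕ) [Fact p.Prime] (m : ℕ)
    {A : (ZMod p)[X]} (hA : A ≠ 0) :
    UpperDensityLE {n | ((X + 1) ^ n * A).support.card < m} 0 := by
  have hp : 1 < p := (Fact.out : p.Prime).one_lt
  have hp0 : (0 : ℝ) < p := by positivity
  have hX : (X + 1 : (ZMod p)[X]) ≠ 0 := X_add_C_ne_zero 1
  have key : ∀ j : ℕ, ∀ A : (ZMod p)[X], A ≠ 0 →
      UpperDensityLE {n | ((X + 1) ^ n * A).support.card < m} ((1 - 1 / p : ℝ) ^ j) := by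
    intro j
    induction j with
    | zero => intro A _; simpa using UpperDensityLE.univ _
    | succ j ih =>
      intro A hA
      obtain ⟨k, hk⟩ : ∃ k, A.natDegree < p ^ k := ⟨_, Nat.lt_pow_self hp⟩
      set q := p ^ (k + 1) with hqdef
      have hq : 0 < q := by positivity
      have hkq : p ^ k * 2 ≤ q := by
        rw [hqdef, pow_succ]
        exact Nat.mul_le_mul_left _ hp
      have hex : ∀ r, ∃ s < q, polySection q s ((X + 1) ^ r * A) ≠ 0 := by
        intro r
        obtain ⟨i, hi⟩ := Polynomial.support_nonempty.2 (mul_ne_zero (pow_ne_zero r hX) hA)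
        refine ⟨i % q, Nat.mod_lt _ hq, fun h0 => ?_⟩
        have h1 := congrArg (fun f => coeff f (i / q)) h0
        simp only [coeff_polySection hq.ne', Nat.div_add_mod', coeff_zero] at h1
        exact (mem_support_iff.1 hi) h1
      choose s hs hs0 using hex
      have hfin : UpperDensityLE (⋃ r ∈ Finset.range q, {n | n % q = r ∧ n / q ∈
          {n | ((X + 1) ^ n * polySection q (s r) ((X + 1) ^ r * A)).support.card < m}})
          (∑ r ∈ Finset.range q, (if r < p ^ k then 0 else (1 - 1 / p : ℝ) ^ j) / (q : ℝ)) := by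
        refine UpperDensityLE.biUnion _ fun r _ => UpperDensityLE.residueClass ?_ hq r
        split_ifs with hr
        · obtain ⟨c, hc, hc'⟩ : ∃ c : ZMod p, c ≠ 0 ∧
              polySection q (s r) ((X + 1) ^ r * A) = C c := by
            have hdeg : ((X + 1) ^ r * A).natDegree < q := by
              refine (natDegree_mul_le).trans_lt ?_
              have : ((X + 1 : (ZMod p)[X]) ^ r).natDegree ≤ r := by
                refine natDegree_pow_le.trans ?_
                have : (X + 1 : (ZMod p)[X]).natDegree = 1 := natDegree_X_add_C 1
                rw [this, mul_one]
              omega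
            have hC : polySection q (s r) ((X + 1) ^ r * A) =
                C ((polySection q (s r) ((X + 1) ^ r * A)).coeff 0) := by
              refine eq_C_of_natDegree_eq_zero ?_
              rw [← Nat.le_zero, natDegree_le_iff_coeff_eq_zero]
              intro i hi
              rw [coeff_polySection hq.ne']
              refine coeff_eq_zero_of_natDegree_lt (hdeg.trans_le ?_)
              nlinarith
            refine ⟨_, fun h0 => hs0 r ?_, hC⟩
            rw [hC, h0, C_0]
          refine (upperDensityLE_card_support_X_add_one_pow p m).mono ?_ le_rfl
          intro n hn
          simp only [Set.mem_ofPred_eq, hc'] at hn ⊢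
          have hsupp : ((X + 1) ^ n * C c).support = ((X + 1 : (ZMod p)[X]) ^ n).support := by
            ext i
            simp [coeff_mul_C, hc]
          rwa [hsupp] at hn
        · exact ih _ (hs0 r)
      refine hfin.mono ?_ ?_
      · intro n hn
        simp only [Set.mem_iUnion]
        refine ⟨n % q, Finset.mem_range.2 (Nat.mod_lt _ hq), rfl, ?_⟩
        have h1 := polySection_X_add_one_pow_mul (k + 1) n (hs (n % q)) A
        have h2 := card_support_polySection_le hq.ne' (s (n % q)) ((X + 1) ^ n * A)
        rw [h1] at h2
        exact h2.trans_lt hn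
      · rw [← Finset.sum_div, Finset.sum_ite, Finset.sum_const_zero, zero_add, Finset.sum_const]
        have hcard : ((Finset.range q).filter fun r => ¬ r < p ^ k).card = q - p ^ k := by
          have : (Finset.range q).filter (fun r => ¬ r < p ^ k) = Finset.Ico (p ^ k) q := by
            ext r; simp; omega
          rw [this, Nat.card_Ico]
        rw [hcard, nsmul_eq_mul, Nat.cast_sub (by omega), pow_succ (1 - 1 / p : ℝ)]
        refine le_of_eq ?_
        rw [hqdef, pow_succ]
        push_cast
        field_simp
  refine UpperDensityLE.of_forall_pos fun ε hε => ?_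
  obtain ⟨j, hj⟩ := exists_pow_lt_of_lt_one hε (show (1 - 1 / p : ℝ) < 1 by
    have : (0 : ℝ) < 1 / p := by positivity
    linarith)
  exact (key j A hA).mono subset_rfl (by linarith)

/-- The Cesàro means of the complex sequence `u` converge. -/
def CesaroConv (u : ℕ → ℂ) : Prop :=
  ∃ l, Tendsto (fun N : ℕ => (N : ℂ)⁻¹ * ∑ n ∈ Finset.range N, u n) atTop (𝓝 l)

lemma CesaroConv.sum_smul {ι : Type*} (s : Finset ι) (c : ι → ℂ) {u : ι → ℕ → ℂ}
    (h : ∀ i ∈ s, CesaroConv (u i)) : CesaroConv fun n => ∑ i ∈ s, c i * u i n := by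
  choose! l hl using h
  refine ⟨∑ i ∈ s, c i * l i, (tendsto_finsetSum s fun i hi => (hl i hi).const_mul (c i)).congr
    fun N => ?_⟩
  rw [Finset.sum_comm, Finset.mul_sum]
  refine Finset.sum_congr rfl fun i _ => ?_
  rw [← Finset.mul_sum]
  ring

lemma CesaroConv.of_eventually_periodic {u : ℕ → ℂ} {n₀ p : ℕ} (hp : 0 < p)
    (h : ∀ n, n₀ ≤ n → u (n + p) = u n) : CesaroConv u := by
  set c : ℂ := (∑ i ∈ Finset.range p, u (n₀ + i)) / p with hc
  have hp' : (p : ℂ) ≠ 0 := by exact_mod_cast hp.ne'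
  set w : ℕ → ℂ := fun N => ∑ n ∈ Finset.range N, (u n - c) with hw
  have hwin : ∀ N, n₀ ≤ N → ∑ i ∈ Finset.range p, u (N + i) = p * c := by
    intro N hN
    induction N, hN using Nat.le_induction with
    | base => rw [hc]; field_simp
    | succ N hN ih =>
      rw [← ih]
      have h1 := Finset.sum_range_succ (fun i => u (N + i)) p
      have h2 := Finset.sum_range_succ' (fun i => u (N + i)) p
      rw [h1, h N hN, add_zero] at h2
      rw [add_right_cancel h2]
      exact Finset.sum_congr rfl fun i _ => by ring_nf
  have hwp : ∀ N, n₀ ≤ N → w (N + p) = w N := by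
    intro N hN
    simp only [hw]
    rw [Finset.sum_range_add, Finset.sum_sub_distrib (f := fun x => u (N + x)), hwin N hN]
    simp
  obtain ⟨M, hM⟩ : ∃ M, ∀ N, ‖w N‖ ≤ M := by
    refine ⟨∑ i ∈ Finset.range (n₀ + p), ‖w i‖, fun N => ?_⟩
    have hsmall : ∀ N, N < n₀ + p → ‖w N‖ ≤ ∑ i ∈ Finset.range (n₀ + p), ‖w i‖ := fun N hN =>
      Finset.single_le_sum (f := fun i => ‖w i‖) (fun i _ => norm_nonneg _) (Finset.mem_range.2 hN)
    induction N using Nat.strong_induction_on with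
    | _ N ih =>
      by_cases hN : N < n₀ + p
      · exact hsmall N hN
      · have h1 := hwp (N - p) (by omega)
        rw [Nat.sub_add_cancel (by omega)] at h1
        rw [h1]
        exact ih _ (by omega)
  refine ⟨c, ?_⟩
  have hlim : Tendsto (fun N : ℕ => (N : ℂ)⁻¹ * w N) atTop (𝓝 0) := by
    refine (tendsto_inv_atTop_nhds_zero_nat (𝕜 := ℂ)).zero_mul_isBoundedUnder_le ?_
    exact isBoundedUnder_of ⟨M, hM⟩
  have h2 := hlim.add_const c
  rw [zero_add] at h2
  refine h2.congr' ?_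
  filter_upwards [eventually_gt_atTop 0] with N hN
  have hN' : (N : ℂ) ≠ 0 := by exact_mod_cast hN.ne'
  simp only [hw, Finset.sum_sub_distrib, Finset.sum_const, Finset.card_range, nsmul_eq_mul]
  field_simp
  ring

lemma CesaroConv.of_finite_orbit {S : Type*} [Finite S] (step : S → S) (x : S) (V : S → ℂ) :
    CesaroConv fun n => V (step^[n] x) := by
  obtain ⟨a, b, hne, hab⟩ := Finite.exists_ne_map_eq_of_infinite fun n : ℕ => step^[n] x
  wlog hlt : a < b generalizing a b
  · exact this b a hne.symm hab.symm (by omega)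
  refine CesaroConv.of_eventually_periodic (n₀ := a) (p := b - a) (by omega) fun n hn => ?_
  obtain ⟨k, rfl⟩ := Nat.exists_eq_add_of_le hn
  have : a + k + (b - a) = k + b := by omega
  rw [this, add_comm a k, Function.iterate_add_apply, Function.iterate_add_apply]
  exact congrArg (fun y => V (step^[k] y)) hab.symm

lemma CesaroConv.of_upperDensityLE {u : ℕ → ℂ} {M : ℝ} (hM : ∀ n, ‖u n‖ ≤ M)
    (h : ∀ ε > 0, UpperDensityLE {n | ε < ‖u n‖} 0) : CesaroConv u := by
  have hM0 : 0 ≤ M := (norm_nonneg _).trans (hM 0)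
  refine ⟨0, ?_⟩
  rw [Metric.tendsto_atTop']
  intro ε hε
  have hδ : 0 < ε / (2 * (M + 1)) := by positivity
  obtain ⟨N₀, hN₀⟩ := eventually_atTop.1 (h (ε / 4) (by positivity) _ hδ)
  refine ⟨N₀, fun N hN => ?_⟩
  have hNpos : (0 : ℝ) < N := by exact_mod_cast (Nat.zero_le N₀).trans_lt hN
  have h1 := hN₀ N hN.le
  rw [zero_add] at h1
  have hcard : (Set.Iio N ∩ {n | ε / 4 < ‖u n‖}).ncard =
      ((Finset.range N).filter fun n => ε / 4 < ‖u n‖).card := by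
    rw [← Set.ncard_coe_finset]
    congr 1
    ext n
    simp
  rw [hcard] at h1
  have h2 : ‖∑ n ∈ Finset.range N, u n‖ ≤ ε / 4 * N +
      M * ((Finset.range N).filter fun n => ε / 4 < ‖u n‖).card := by
    refine (norm_sum_le _ _).trans ?_
    have : ∀ n ∈ Finset.range N, ‖u n‖ ≤ ε / 4 + (if ε / 4 < ‖u n‖ then M else 0) := by
      intro n _
      split_ifs with hn
      · have := hM n
        linarith
      · linarith
    refine (Finset.sum_le_sum this).trans (le_of_eq ?_)
    rw [Finset.sum_add_distrib, ← Finset.sum_filter, Finset.sum_const, Finset.sum_const,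
      Finset.card_range, nsmul_eq_mul, nsmul_eq_mul]
    ring
  rw [dist_zero_right, norm_mul, norm_inv, Complex.norm_natCast, inv_mul_lt_iff₀ hNpos]
  have h3 : M * (ε / (2 * (M + 1)) * N) ≤ ε / 2 * N := by
    have : M * (ε / (2 * (M + 1))) ≤ ε / 2 := by
      rw [mul_div_assoc', div_le_iff₀ (by positivity)]
      nlinarith
    calc _ = M * (ε / (2 * (M + 1))) * N := by ring
      _ ≤ _ := by gcongr
  calc _ ≤ _ := h2
    _ ≤ ε / 4 * N + M * (ε / (2 * (M + 1)) * N) := by gcongr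
    _ < N * ε := by nlinarith

section Cylinder

variable {G : Type*} [TopologicalSpace G] [DiscreteTopology G]

lemma continuous_of_dependsOn {α : Type*} [TopologicalSpace α] {f : (ℤ → G) → α}
    {s : Set ℤ} (hs : s.Finite) (h : DependsOn f s) : Continuous f := by
  refine IsLocallyConstant.continuous ?_
  rw [IsLocallyConstant.iff_eventually_eq]
  intro x
  have hopen : ∀ᶠ y in 𝓝 x, ∀ i ∈ s, y i = x i := by
    refine (Filter.eventually_all_finite hs).2 fun i _ => ?_
    have hc : Continuous fun y : ℤ → G => y i := continuous_apply i
    exact hc.continuousAt.eventually_mem ((isOpen_discrete {x i}).mem_nhds rfl)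
  filter_upwards [hopen] with y hy
  exact h hy

lemma exists_dependsOn_near [Finite G] (f : C(ℤ → G, ℝ)) {ε : ℝ} (hε : 0 < ε) :
    ∃ (g : C(ℤ → G, ℝ)) (W : ℕ), DependsOn g (Set.Icc (-(W : ℤ)) W) ∧ ∀ x, |f x - g x| ≤ ε := by
  have hcomb : ∀ {g h : C(ℤ → G, ℝ)} (op : ℝ → ℝ → ℝ) (k : C(ℤ → G, ℝ)),
      (∃ W : ℕ, DependsOn g (Set.Icc (-(W : ℤ)) W)) →
      (∃ W : ℕ, DependsOn h (Set.Icc (-(W : ℤ)) W)) → (∀ x, k x = op (g x) (h x)) →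
      ∃ W : ℕ, DependsOn k (Set.Icc (-(W : ℤ)) W) := by
    rintro g h op k ⟨W, hW⟩ ⟨W', hW'⟩ hk
    refine ⟨max W W', fun x y hxy => ?_⟩
    rw [hk, hk, hW fun i hi => hxy i ?_, hW' fun i hi => hxy i ?_] <;>
    · simp only [Set.mem_Icc] at hi ⊢
      push_cast
      omega
  let A : Subalgebra ℝ C(ℤ → G, ℝ) :=
    { carrier := {g | ∃ W : ℕ, DependsOn g (Set.Icc (-(W : ℤ)) W)}
      mul_mem' := fun {a b} ha hb => hcomb (· * ·) (a * b) ha hb fun _ => rfl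
      add_mem' := fun {a b} ha hb => hcomb (· + ·) (a + b) ha hb fun _ => rfl
      algebraMap_mem' := fun r => ⟨0, fun _ _ _ => rfl⟩ }
  have hsep : A.SeparatesPoints := by
    classical
    intro x y hxy
    obtain ⟨i, hi⟩ := Function.ne_iff.1 hxy
    have hdep : DependsOn (fun z : ℤ → G => if z i = x i then (1 : ℝ) else 0)
        (Set.Icc (-(i.natAbs : ℤ)) i.natAbs) := by
      intro z z' h
      have : z i = z' i := h i (by simp only [Set.mem_Icc]; omega)
      simp only [this]
    refine ⟨_, ⟨⟨_, continuous_of_dependsOn (Set.finite_Icc _ _) hdep⟩, ⟨_, hdep⟩, rfl⟩, ?_⟩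
    simp [Ne.symm hi]
  have htop := ContinuousMap.subalgebra_topologicalClosure_eq_top_of_separatesPoints A hsep
  have hmem : f ∈ A.topologicalClosure := by rw [htop]; trivial
  obtain ⟨g, ⟨W, hW⟩, hg⟩ := Metric.mem_closure_iff.1 hmem ε hε
  refine ⟨g, W, hW, fun x => ?_⟩
  rw [← Real.dist_eq]
  exact (ContinuousMap.dist_apply_le_dist x).trans hg.le

variable [Finite G] [MeasurableSpace G] [MeasurableSingletonClass G]

lemma measurable_of_dependsOn {α : Type*} [MeasurableSpace α] [TopologicalSpace α] [BorelSpace α]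
    {f : (ℤ → G) → α} {s : Set ℤ} (hs : s.Finite) (h : DependsOn f s) : Measurable f :=
  (continuous_of_dependsOn hs h).measurable

lemma integrable_of_dependsOn {μ : Measure (ℤ → G)} [IsFiniteMeasure μ] {E : Type*}
    [NormedAddCommGroup E] {f : (ℤ → G) → E} {s : Set ℤ} (hs : s.Finite) (h : DependsOn f s) :
    Integrable f μ := by
  have := (continuous_of_dependsOn hs h)
  exact this.integrable_of_hasCompactSupport (HasCompactSupport.of_compactSpace f)

/-- If the Cesàro means converge on functions of finitely many coordinates, they converge to a
probability measure. -/
lemma exists_cesaroTendstoTo {μ : Measure (ℤ → G)} [IsProbabilityMeasure μ]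
    {Φ : (ℤ → G) → (ℤ → G)} (hΦ : Continuous Φ)
    (h : ∀ (f : C(ℤ → G, ℝ)) (W : ℕ), DependsOn f (Set.Icc (-(W : ℤ)) W) →
      CesaroConv fun n => ∫ x, (f (Φ^[n] x) : ℂ) ∂μ) :
    ∃ κ : Measure (ℤ → G), IsProbabilityMeasure κ ∧ CesaroTendstoTo μ Φ κ := by
  set a : C(ℤ → G, ℝ) → ℕ → ℝ := fun f N =>
    (N : ℝ)⁻¹ * ∑ n ∈ Finset.range N, ∫ x, f (Φ^[n] x) ∂μ with ha
  have hintg : ∀ (f : C(ℤ → G, ℝ)) n, Integrable (fun x => f (Φ^[n] x)) μ := fun f n =>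
    (f.continuous.comp (hΦ.iterate n)).integrable_of_hasCompactSupport
      (HasCompactSupport.of_compactSpace _)
  have hcyl : ∀ (f : C(ℤ → G, ℝ)) (W : ℕ), DependsOn f (Set.Icc (-(W : ℤ)) W) →
      CauchySeq (a f) := by
    intro f W hf
    obtain ⟨l, hl⟩ := h f W hf
    have : Tendsto (a f) atTop (𝓝 l.re) := by
      refine ((Complex.continuous_re.tendsto l).comp hl).congr fun N => ?_
      simp only [Function.comp, ha, integral_complex_ofReal]
      rw [← Complex.ofReal_natCast, ← Complex.ofReal_inv, ← Complex.ofReal_sum,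
        ← Complex.ofReal_mul, Complex.ofReal_re]
    exact this.cauchySeq
  have hclose : ∀ (f g : C(ℤ → G, ℝ)) {ε : ℝ}, 0 ≤ ε → (∀ x, |f x - g x| ≤ ε) →
      ∀ N, |a f N - a g N| ≤ ε := by
    intro f g ε hε hfg N
    rcases Nat.eq_zero_or_pos N with rfl | hN
    · simpa [ha] using hε
    have hN' : (0 : ℝ) < N := by exact_mod_cast hN
    simp only [ha]
    rw [← mul_sub, ← Finset.sum_sub_distrib, abs_mul, abs_of_pos (inv_pos.2 hN'),
      inv_mul_le_iff₀ hN']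
    refine (Finset.abs_sum_le_sum_abs _ _).trans ?_
    refine (Finset.sum_le_card_nsmul _ _ ε fun n _ => ?_).trans (by simp)
    rw [← integral_sub (hintg f n) (hintg g n)]
    have := norm_integral_le_of_norm_le_const (μ := μ) (C := ε)
      (f := fun x => f (Φ^[n] x) - g (Φ^[n] x)) (ae_of_all _ fun x => hfg _)
    simpa using this
  have hconv : ∀ f, ∃ l, Tendsto (a f) atTop (𝓝 l) := by
    intro f
    refine cauchySeq_tendsto_of_complete ?_
    rw [Metric.cauchySeq_iff']
    intro ε hε
    obtain ⟨g, W, hg, hfg⟩ := exists_dependsOn_near f (show 0 < ε / 4 by positivity)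
    obtain ⟨N, hN⟩ := Metric.cauchySeq_iff'.1 (hcyl g W hg) (ε / 4) (by positivity)
    refine ⟨N, fun n hn => ?_⟩
    have h1 := hN n hn
    have h2 := hclose f g (by positivity) hfg n
    have h3 := hclose f g (by positivity) hfg N
    rw [Real.dist_eq] at h1 ⊢
    rw [abs_lt] at h1 ⊢
    rw [abs_le] at h2 h3
    constructor <;> linarith
  have hmeas : ∀ n, AEMeasurable (Φ^[n]) μ := fun n => (hΦ.iterate n).measurable.aemeasurable
  let κN : ℕ → ProbabilityMeasure (ℤ → G) := fun N =>
    ⟨((N + 1 : ℕ) : ℝ≥0∞)⁻¹ • ∑ n ∈ Finset.range (N + 1), μ.map (Φ^[n]), ⟨by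
      have : ∀ n, (μ.map (Φ^[n])) Set.univ = 1 := fun n =>
        (Measure.isProbabilityMeasure_map (hmeas n)).measure_univ
      rw [Measure.smul_apply, Measure.finsetSum_apply]
      simp only [this, Finset.sum_const, Finset.card_range, nsmul_eq_mul, mul_one, smul_eq_mul]
      exact ENNReal.inv_mul_cancel (by simp) (by simp)⟩⟩
  have hκN : ∀ N (f : C(ℤ → G, ℝ)), ∫ x, f x ∂(κN N : Measure (ℤ → G)) = a f (N + 1) := by
    intro N f
    change ∫ x, f x ∂(((N + 1 : ℕ) : ℝ≥0∞)⁻¹ • ∑ n ∈ Finset.range (N + 1), μ.map (Φ^[n])) = _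
    rw [integral_smul_measure, integral_finsetSum_measure]
    · simp only [ha, smul_eq_mul, ENNReal.toReal_inv, ENNReal.toReal_natCast]
      congr 1
      refine Finset.sum_congr rfl fun n _ => ?_
      rw [integral_map (hmeas n) f.continuous.aestronglyMeasurable]
    · intro n _
      have := Measure.isProbabilityMeasure_map (hmeas n)
      exact f.continuous.integrable_of_hasCompactSupport (HasCompactSupport.of_compactSpace _)
  obtain ⟨κ, hκ⟩ := exists_clusterPt_of_compactSpace (map κN atTop)
  refine ⟨κ, inferInstance, fun f => ?_⟩
  obtain ⟨l, hl⟩ := hconv f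
  have hmc : MapClusterPt κ atTop κN := hκ
  have hcont : Continuous fun ν : ProbabilityMeasure (ℤ → G) => ∫ x, f x ∂(ν : Measure (ℤ → G)) :=
    ProbabilityMeasure.continuous_integral_boundedContinuousFunction
      (BoundedContinuousFunction.mkOfCompact f)
  have h1 := hmc.tendsto_comp (hcont.tendsto κ)
  have h2 : Tendsto ((fun ν : ProbabilityMeasure (ℤ → G) => ∫ x, f x ∂(ν : Measure (ℤ → G))) ∘ κN)
      atTop (𝓝 l) := by
    refine ((tendsto_add_atTop_iff_nat 1).2 hl).congr fun N => ?_
    exact (hκN N f).symm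
  have h3 : ∫ x, f x ∂(κ : Measure (ℤ → G)) = l := eq_of_nhds_neBot (ClusterPt.mono h1 h2)
  rw [h3]
  exact hl

end Cylinder

section Distortion

variable {A : Type*} {E : Set (A × A)}

/-- The translate of a sequence by `t`. -/
def translate (t : ℤ) (x : ℤ → A) : ℤ → A := fun i => x (i + t)

@[simp] lemma translate_apply (t : ℤ) (x : ℤ → A) (i : ℤ) : translate t x i = x (i + t) := rfl

lemma translate_translate (s t : ℤ) (x : ℤ → A) :
    translate s (translate t x) = translate (s + t) x := by
  ext i
  simp [add_assoc]

lemma translate_zero (x : ℤ → A) : translate 0 x = x := by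
  ext i
  simp

lemma translate_mem_TMC {x : ℤ → A} (hx : x ∈ TMC E) (t : ℤ) : translate t x ∈ TMC E := by
  intro i
  have := hx (i + t)
  simp only [translate_apply]
  rwa [show i + 1 + t = i + t + 1 by ring]

/-- Gluing two points of a TMC at a common letter. -/
lemma splice_mem_TMC {x z : ℤ → A} (hz : z ∈ TMC E) (hx : x ∈ TMC E) {e : ℤ} (h : z e = x e) :
    (fun i => if i ≤ e then z i else x i) ∈ TMC E := by
  intro i
  by_cases h1 : i + 1 ≤ e
  · have h2 : i ≤ e := by omega
    simpa [h1, h2] using hz i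
  · by_cases h2 : i ≤ e
    · have h3 : i = e := by omega
      subst h3
      simpa [h] using hx i
    · simpa [h1, h2] using hx i

/-- The cylinder of sequences that agree with `x` on `[a, b)`. -/
def box (x : ℤ → A) (a b : ℤ) : Set (ℤ → A) := {z | ∀ i ∈ Set.Ico a b, z i = x i}

lemma box_congr {x y : ℤ → A} {a b : ℤ} (h : ∀ i ∈ Set.Ico a b, x i = y i) :
    box x a b = box y a b := by
  ext z
  exact forall₂_congr fun i hi => by rw [h i hi]

lemma box_anti (x : ℤ → A) {a b a' b' : ℤ} (ha : a' ≤ a) (hb : b ≤ b') :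
    box x a' b' ⊆ box x a b :=
  fun _ hz i hi => hz i ⟨ha.trans hi.1, hi.2.trans_le hb⟩

lemma preimage_translate_box (x : ℤ → A) (a b t : ℤ) :
    translate t ⁻¹' box (translate t x) a b = box x (a + t) (b + t) := by
  ext z
  simp only [box, Set.preimage_ofPred_eq, Set.mem_ofPred_eq, translate_apply, Set.mem_Ico]
  refine ⟨fun h i hi => ?_, fun h i hi => h _ (by omega)⟩
  have := h (i - t) (by omega)
  simpa using this

variable [MeasurableSpace A]

lemma measurable_translate (t : ℤ) : Measurable (translate (A := A) t) :=
  measurable_pi_lambda _ fun i => measurable_pi_apply (i + t)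

lemma measurePreserving_translate {μ : Measure (ℤ → A)} (h : Measure.map shiftMap μ = μ) (t : ℤ) :
    MeasurePreserving (translate t) μ μ := by
  have h1 : MeasurePreserving (translate 1) μ μ := ⟨measurable_translate 1, h⟩
  have h2 : MeasurePreserving (translate (-1)) μ μ := by
    refine ⟨measurable_translate _, ?_⟩
    conv_lhs => rw [← h1.map_eq]
    rw [Measure.map_map (measurable_translate _) (measurable_translate _)]
    have : translate (A := A) (-1) ∘ translate 1 = id := by
      ext x i
      simp
    rw [this, Measure.map_id]
  induction t with
  | zero =>
    have : translate (A := A) 0 = id := funext translate_zero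
    rw [this]
    exact MeasurePreserving.id μ
  | succ i ih =>
    have : translate (A := A) (i + 1) = translate i ∘ translate 1 := by
      ext x j
      simp [add_assoc]
    rw [this]
    exact ih.comp h1
  | pred i ih =>
    have : translate (A := A) (-i - 1) = translate (-i) ∘ translate (-1) := by
      ext x j
      simp [add_assoc, sub_eq_add_neg]
    rw [this]
    exact ih.comp h2

/-- The conditional probability of the letter `x 0` given the preceding `n` letters of `x`. -/
noncomputable def stepRatio (μ : Measure (ℤ → A)) (x : ℤ → A) (n : ℕ) : ℝ :=
  μ.real (box x (-n) 1) / μ.real (box x (-n) 0)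

lemma stepRatio_nonneg (μ : Measure (ℤ → A)) (x : ℤ → A) (n : ℕ) : 0 ≤ stepRatio μ x n :=
  div_nonneg measureReal_nonneg measureReal_nonneg

variable [MeasurableSingletonClass A]

lemma measurableSet_box (x : ℤ → A) (a b : ℤ) : MeasurableSet (box x a b) := by
  have : box x a b = ⋂ i ∈ Set.Ico a b, (fun z : ℤ → A => z i) ⁻¹' {x i} := by
    ext z
    simp [box]
  rw [this]
  exact MeasurableSet.biInter (Set.to_countable _) fun i _ =>
    measurable_pi_apply i (measurableSet_singleton _)

variable {μ : Measure (ℤ → A)}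

lemma GoodMeasure.measureReal_box_translate (h : GoodMeasure E μ) (x : ℤ → A) (a b t : ℤ) :
    μ.real (box (translate t x) a b) = μ.real (box x (a + t) (b + t)) := by
  rw [← preimage_translate_box, measureReal_def, measureReal_def,
    (measurePreserving_translate h.2.1 t).measure_preimage
      (measurableSet_box _ _ _).nullMeasurableSet]

lemma GoodMeasure.measureReal_cyl (h : GoodMeasure E μ) (x : ℤ → A) (a : ℤ) {m : ℕ}
    (w : Fin m → A) (hw : ∀ j : Fin m, w j = x (a + (j : ℕ))) :
    (μ (cyl w)).toReal = μ.real (box x a (a + m)) := by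
  have h1 := h.measureReal_box_translate x 0 m a
  rw [zero_add, add_comm] at h1
  rw [← h1, measureReal_def]
  congr 2
  ext z
  simp only [cyl, box, Set.mem_ofPred_eq, translate_apply, Set.mem_Ico, hw]
  constructor
  · intro hz i hi
    have := hz ⟨i.toNat, by omega⟩
    simp only [Int.toNat_of_nonneg hi.1] at this
    rw [this, add_comm]
  · intro hz i
    rw [hz i (by omega), add_comm]

lemma GoodMeasure.measureReal_box_pos (h : GoodMeasure E μ) {x : ℤ → A} (hx : x ∈ TMC E)
    (a b : ℤ) : 0 < μ.real (box x a b) := by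
  have := h.1
  rcases le_or_gt a b with hab | hab
  · have h1 := h.measureReal_cyl x a (m := (b - a).toNat) (fun j => x (a + (j : ℕ))) fun j => rfl
    rw [Int.toNat_of_nonneg (by omega), add_sub_cancel] at h1
    rw [← h1]
    exact ENNReal.toReal_pos (h.2.2.2 _ _ ⟨x, hx, a, fun _ => rfl⟩).ne' (measure_ne_top _ _)
  · have : box x a b = Set.univ := by
      ext z
      simp only [box, Set.mem_Ico, Set.mem_ofPred_eq, Set.mem_univ, iff_true]
      intro i hi
      omega
    simp [this]


lemma measurableSet_TMC [Finite A] (E : Set (A × A)) : MeasurableSet (TMC E) := by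
  have : TMC E = ⋂ i : ℤ, (fun x : ℤ → A => (x i, x (i + 1))) ⁻¹' E := by
    ext x
    simp [TMC]
  rw [this]
  exact MeasurableSet.iInter fun i =>
    ((measurable_pi_apply i).prodMk (measurable_pi_apply (i + 1))) E.to_countable.measurableSet

lemma GoodMeasure.measureReal_box_succ (h : GoodMeasure E μ) {x : ℤ → A} (hx : x ∈ TMC E)
    (a : ℤ) (n : ℕ) : μ.real (box x a (a + n + 1)) =
      stepRatio μ (translate (a + n) x) n * μ.real (box x a (a + n)) := by
  rw [stepRatio, h.measureReal_box_translate, h.measureReal_box_translate, add_comm 1,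
    show -(n : ℤ) + (a + n) = a by ring, zero_add,
    div_mul_cancel₀ _ (h.measureReal_box_pos hx _ _).ne']

lemma measureReal_eq_sum_inter [Fintype A] [IsFiniteMeasure μ] (S : Set (ℤ → A)) (e : ℤ) :
    μ.real S = ∑ c, μ.real ({z | z e = c} ∩ S) := by
  have h1 : S = ⋃ c, {z : ℤ → A | z e = c} ∩ S := by
    ext z
    simp
  have hm : ∀ c : A, MeasurableSet {z : ℤ → A | z e = c} := fun c =>
    measurable_pi_apply (X := fun _ => A) e (measurableSet_singleton c)
  have h2 := sum_measure_preimage_singleton (μ := μ.restrict S) (f := fun z : ℤ → A => z e)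
    Finset.univ fun c _ => hm c
  simp only [Finset.coe_univ, Set.preimage_univ, Measure.restrict_apply_univ] at h2
  rw [measureReal_def, ← h2, ENNReal.toReal_sum fun c _ => measure_ne_top _ _]
  refine Finset.sum_congr rfl fun c _ => ?_
  rw [Measure.restrict_apply (measurable_pi_apply e (measurableSet_singleton c))]
  rfl

variable [Finite A]

lemma GoodMeasure.ae_mem (h : GoodMeasure E μ) : ∀ᵐ x ∂μ, x ∈ TMC E := by
  have := h.1
  exact (prob_compl_eq_zero_iff (measurableSet_TMC E)).2 h.2.2.1

lemma GoodMeasure.exists_mem_box (h : GoodMeasure E μ) {S : Set (ℤ → A)} (hpos : μ S ≠ 0) :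
    ∃ z ∈ S, z ∈ TMC E := by
  by_contra! hcon
  refine hpos (measure_mono_null ?_ (ae_iff.1 h.ae_mem))
  exact fun z hz => hcon z hz

lemma GoodMeasure.exists_stepRatio_succ (h : GoodMeasure E μ) (ε : ℝ) {x : ℤ → A}
    (hx : x ∈ TMC E) {n : ℕ} (hn : 1 ≤ n) :
    ∃ y ∈ TMC E, (∀ i, -(n : ℤ) ≤ i → y i = x i) ∧
      ε * stepRatio μ x n ≤ ε * stepRatio μ y (n + 1) := by
  have := h.1
  have := Fintype.ofFinite A
  set N : A → ℝ := fun c => μ.real ({z | z (-n - 1) = c} ∩ box x (-n) 1) with hN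
  set D : A → ℝ := fun c => μ.real ({z | z (-n - 1) = c} ∩ box x (-n) 0) with hD
  have hNs : μ.real (box x (-n) 1) = ∑ c, N c := measureReal_eq_sum_inter _ _
  have hDs : μ.real (box x (-n) 0) = ∑ c, D c := measureReal_eq_sum_inter _ _
  have hDpos := h.measureReal_box_pos hx (-n) 0
  have hND : ∀ c, N c ≤ D c := fun c =>
    measureReal_mono (Set.inter_subset_inter_right _ (box_anti x le_rfl zero_le_one))
  obtain ⟨c, hc, hcr⟩ : ∃ c, 0 < D c ∧ ε * (∑ c, N c) * D c ≤ ε * N c * (∑ c, D c) := by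
    by_contra! hcon
    have hle : ∀ c, ε * N c * (∑ c, D c) ≤ ε * (∑ c, N c) * D c := by
      intro c
      rcases (show 0 ≤ D c from measureReal_nonneg).eq_or_lt with h0 | h0
      · have : N c = 0 := le_antisymm ((hND c).trans h0.symm.le) measureReal_nonneg
        rw [this, ← h0]
        simp
      · exact (hcon c h0).le
    obtain ⟨c, -, hc⟩ : ∃ c ∈ Finset.univ, 0 < D c := by
      refine Finset.exists_lt_of_sum_lt ?_
      rw [← hDs]
      simpa using hDpos
    have := Finset.sum_lt_sum (fun c _ => hle c) ⟨c, Finset.mem_univ c, hcon c hc⟩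
    rw [← Finset.sum_mul, ← Finset.mul_sum, ← Finset.mul_sum] at this
    exact lt_irrefl _ this
  obtain ⟨z, ⟨hzc, hzx⟩, hz⟩ := h.exists_mem_box
    (S := {z | z (-n - 1) = c} ∩ box x (-n) 0) fun h0 => by
      simp only [hD, measureReal_def, h0, ENNReal.toReal_zero, lt_irrefl] at hc
  have hzx' : ∀ i, -(n : ℤ) ≤ i → i < 0 → z i = x i := fun i h1 h2 => hzx i ⟨h1, h2⟩
  refine ⟨_, splice_mem_TMC (e := -1) hz hx (hzx' _ (by omega) (by omega)), ?_, ?_⟩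
  · intro i hi
    by_cases h1 : i ≤ -1
    · simpa [h1] using hzx' i hi (by omega)
    · simp [h1]
  set y : ℤ → A := fun i => if i ≤ -1 then z i else x i with hy
  have hyx : ∀ i, -(n : ℤ) ≤ i → y i = x i := by
    intro i hi
    by_cases h1 : i ≤ -1
    · simpa [hy, h1] using hzx' i hi (by omega)
    · simp [hy, h1]
  have hyc : y (-n - 1) = c := by
    have : -(n : ℤ) - 1 ≤ -1 := by omega
    simp only [hy, this, if_true]
    exact hzc
  have hbox : ∀ e, -(n : ℤ) ≤ e →
      box y (-(n + 1 : ℕ)) e = {z | z (-n - 1) = c} ∩ box x (-n) e := by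
    intro e he
    ext v
    simp only [box, Set.mem_ofPred_eq, Set.mem_inter_iff, Set.mem_Ico]
    constructor
    · intro hv
      refine ⟨?_, fun i hi => ?_⟩
      · rw [hv (-n - 1) (by push_cast; omega), hyc]
      · rw [hv i (by push_cast; omega), hyx i hi.1]
    · rintro ⟨h1, h2⟩ i ⟨h3, h4⟩
      push_cast at h3
      rcases eq_or_ne i (-n - 1) with rfl | h5
      · rw [h1, hyc]
      · rw [h2 i (by omega), hyx i (by omega)]
  rw [stepRatio, stepRatio, hbox 1 (by omega), hbox 0 (by omega), ← mul_div_assoc,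
    ← mul_div_assoc, div_le_div_iff₀ hDpos hc, hNs, hDs]
  exact hcr

lemma GoodMeasure.exists_past (h : GoodMeasure E μ) {ν : (ℕ → A) → A → ℝ}
    (hν : ∀ p, IsPast E p → ∀ a, (p 0, a) ∈ E → Tendsto (fun m : ℕ =>
      (μ (cyl (Fin.snoc (pastWord p m) a))).toReal / (μ (cyl (pastWord p m))).toReal)
        atTop (𝓝 (ν p a))) (ε : ℝ) {x : ℤ → A} (hx : x ∈ TMC E) {n : ℕ} (hn : 1 ≤ n) :
    ∃ p, IsPast E p ∧ (∀ i < n, p i = x (-1 - i)) ∧ ε * stepRatio μ x n ≤ ε * ν p (x 0) := by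
  choose! f hf using fun (x : ℤ → A) (n : ℕ) (hx : x ∈ TMC E ∧ 1 ≤ n) =>
    h.exists_stepRatio_succ ε hx.1 hx.2
  obtain ⟨y, hy0, hys⟩ : ∃ y : ℕ → ℤ → A, y 0 = x ∧ ∀ k, y (k + 1) = f (y k) (n + k) :=
    ⟨fun k => Nat.rec x (fun k z => f z (n + k)) k, rfl, fun k => rfl⟩
  have hyE : ∀ k, y k ∈ TMC E := by
    intro k
    induction k with
    | zero => rwa [hy0]
    | succ k ih =>
      rw [hys]
      exact (hf (y k) (n + k) ⟨ih, by omega⟩).1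
  have hyy : ∀ k j, ∀ i, -((n + k : ℕ) : ℤ) ≤ i → y (k + j) i = y k i := by
    intro k j
    induction j with
    | zero => exact fun i _ => rfl
    | succ j ih =>
      intro i hi
      rw [← add_assoc, hys, (hf (y (k + j)) (n + (k + j)) ⟨hyE _, by omega⟩).2.1 i
        (by push_cast at hi ⊢; omega), ih i hi]
  have hmono : Monotone fun k => ε * stepRatio μ (y k) (n + k) :=
    monotone_nat_of_le_succ fun k => by
      rw [hys]
      exact (hf (y k) (n + k) ⟨hyE _, by omega⟩).2.2
  let p : ℕ → A := fun i => y i (-1 - i)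
  have hp : ∀ k i, i < n + k → p i = y k (-1 - i) := by
    intro k i hi
    rcases le_total i k with hik | hik
    · obtain ⟨j, rfl⟩ := Nat.exists_eq_add_of_le hik
      rw [hyy i j _ (by push_cast; omega)]
    · obtain ⟨j, rfl⟩ := Nat.exists_eq_add_of_le hik
      exact hyy k j _ (by push_cast at hi ⊢; omega)
  have hpast : IsPast E p := by
    intro i
    rw [hp (i + 1) (i + 1) (by omega), hp (i + 1) i (by omega)]
    have := hyE (i + 1) (-1 - ((i + 1 : ℕ) : ℤ))
    rwa [show (-1 - ((i + 1 : ℕ) : ℤ)) + 1 = -1 - i by push_cast; ring] at this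
  have hp0 : (p 0, x 0) ∈ E := by
    rw [hp 0 0 (by omega), hy0]
    simpa using hx (-1)
  refine ⟨p, hpast, fun i hi => by rw [hp 0 i (by omega), hy0], ?_⟩
  refine ge_of_tendsto (((hν p hpast _ hp0).const_mul ε).comp (tendsto_add_atTop_nat n)) ?_
  refine Eventually.of_forall fun k => ?_
  have hy00 : y k 0 = x 0 := by
    have := hyy 0 k 0 (by omega)
    rwa [zero_add, hy0] at this
  have h1 : (μ (cyl (pastWord p (k + n)))).toReal = μ.real (box (y k) (-(n + k : ℕ)) 0) := by
    rw [h.measureReal_cyl (y k) (-(n + k : ℕ))]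
    · rw [show -((n + k : ℕ) : ℤ) + ((k + n : ℕ) : ℤ) = 0 by push_cast; ring]
    · intro j
      have hj := j.2
      rw [pastWord, hp k _ (by omega)]
      congr 1
      omega
  have h2 : (μ (cyl (Fin.snoc (pastWord p (k + n)) (x 0) : Fin (k + n + 1) → A))).toReal =
      μ.real (box (y k) (-(n + k : ℕ)) 1) := by
    rw [h.measureReal_cyl (y k) (-(n + k : ℕ))]
    · rw [show -((n + k : ℕ) : ℤ) + ((k + n + 1 : ℕ) : ℤ) = 1 by push_cast; ring]
    · intro j
      refine Fin.lastCases ?_ (fun j => ?_) j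
      · rw [Fin.snoc_last, ← hy00]
        congr 1
        simp only [Fin.val_last]
        push_cast
        ring
      · have hj := j.2
        rw [Fin.snoc_castSucc, pastWord, hp k _ (by omega)]
        congr 1
        simp only [Fin.val_castSucc]
        omega
  simp only [Function.comp]
  rw [h1, h2]
  conv_lhs => rw [← hy0]
  exact hmono (Nat.zero_le k)

lemma GoodMeasure.exists_stepRatio_le (h : GoodMeasure E μ) (hc : CCSD E μ) :
    ∃ γ : ℕ → ℝ, Summable γ ∧ (∀ m, 0 ≤ γ m) ∧ ∀ x ∈ TMC E, ∀ y ∈ TMC E, ∀ j n n' : ℕ, 1 ≤ j →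
      j ≤ n → j ≤ n' → (∀ i ∈ Set.Icc (-(j : ℤ)) 0, x i = y i) →
        stepRatio μ x n ≤ (1 + γ j) * stepRatio μ y n' := by
  obtain ⟨ν, hν, γ, hγ, hd⟩ := hc
  refine ⟨fun m => |γ m|, hγ.abs, fun m => abs_nonneg _, ?_⟩
  intro x hx y hy j n n' hj hn hn' hxy
  obtain ⟨p, hp, hpx, hp1⟩ := h.exists_past (fun p hp a ha => (hν p hp a ha).2) 1 hx (hj.trans hn)
  obtain ⟨q, hq, hqy, hq1⟩ :=
    h.exists_past (fun p hp a ha => (hν p hp a ha).2) (-1) hy (hj.trans hn')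
  have hp0 : (p 0, x 0) ∈ E := by
    rw [hpx 0 (by omega)]
    simpa using hx (-1)
  have hxy0 : x 0 = y 0 := hxy 0 ⟨by omega, le_rfl⟩
  have hpq : ∀ i < j, p i = q i := by
    intro i hi
    rw [hpx i (by omega), hqy i (by omega), hxy _ ⟨by omega, by omega⟩]
  have h1 := (abs_le.1 ((hd j hj p q hp hq hpq (x 0) hp0).trans (le_abs_self _))).2
  have hqpos := (hν q hq (x 0) (by rw [← hpq 0 (by omega)]; exact hp0)).1
  rw [sub_le_iff_le_add, div_le_iff₀ hqpos] at h1
  rw [← hxy0] at hq1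
  calc stepRatio μ x n ≤ ν p (x 0) := by linarith
    _ ≤ (|γ j| + 1) * ν q (x 0) := h1
    _ ≤ (1 + |γ j|) * stepRatio μ y n' := by
      rw [add_comm]
      exact mul_le_mul_of_nonneg_left (by linarith) (by positivity)

lemma GoodMeasure.exists_le_stepRatio (h : GoodMeasure E μ) (hc : CCSD E μ) :
    ∃ δ : ℝ, 0 < δ ∧ ∀ x ∈ TMC E, ∀ n : ℕ, 1 ≤ n → δ ≤ stepRatio μ x n := by
  have := h.1
  obtain ⟨γ, -, hγ, hd⟩ := h.exists_stepRatio_le hc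
  have hfin : (Set.range fun x : TMC E => μ.real (box x.1 (-1) 1)).Finite := by
    refine (Set.finite_range fun w : A × A =>
      μ.real (box (fun i => if i = -1 then w.1 else w.2) (-1) 1)).subset ?_
    rintro _ ⟨x, rfl⟩
    refine ⟨(x.1 (-1), x.1 0), congrArg _ (box_congr fun i hi => ?_)⟩
    obtain rfl | rfl : i = -1 ∨ i = 0 := by
      have := hi.1
      have := hi.2
      omega
    · simp
    · simp
  obtain ⟨δ, hδ, hδx⟩ : ∃ δ : ℝ, 0 < δ ∧ ∀ x ∈ TMC E, δ ≤ μ.real (box x (-1) 1) := by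
    rcases (TMC E).eq_empty_or_nonempty with he | ⟨x₀, hx₀⟩
    · exact ⟨1, one_pos, by simp [he]⟩
    obtain ⟨m, ⟨x, rfl⟩, hx⟩ := hfin.exists_minimal ⟨_, ⟨⟨x₀, hx₀⟩, rfl⟩⟩
    refine ⟨_, h.measureReal_box_pos x.2 (-1) 1, fun y hy => ?_⟩
    exact (le_total _ _).elim id fun hle => hx ⟨⟨y, hy⟩, rfl⟩ hle
  have h1 : 0 < 1 + γ 1 := by linarith [hγ 1]
  refine ⟨δ / (1 + γ 1), div_pos hδ h1, fun x hx n hn => ?_⟩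
  rw [div_le_iff₀' h1]
  refine ((hδx x hx).trans ?_).trans (hd x hx x hx 1 1 n le_rfl le_rfl hn fun _ _ => rfl)
  rw [stepRatio, le_div_iff₀ (h.measureReal_box_pos hx _ _)]
  exact mul_le_of_le_one_right measureReal_nonneg measureReal_le_one

/-- Bounded distortion: changing a bounded block of coordinates changes the measure of a long
cylinder by at most a bounded factor. -/
lemma GoodMeasure.exists_measureReal_box_le (h : GoodMeasure E μ) (hc : CCSD E μ) (l : ℕ) :
    ∃ C : ℝ, 0 < C ∧ ∀ x ∈ TMC E, ∀ y ∈ TMC E, (∀ i, i ∉ Set.Ico (0 : ℤ) l → y i = x i) →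
      ∀ M j : ℕ, 1 ≤ M →
        μ.real (box y (-M) (l + 1 + j)) ≤ C * μ.real (box x (-M) (l + 1 + j)) := by
  have := h.1
  obtain ⟨γ, hγs, hγ, hd⟩ := h.exists_stepRatio_le hc
  obtain ⟨δ, hδ, hδx⟩ := h.exists_le_stepRatio hc
  have hsucc : ∀ x ∈ TMC E, ∀ M k : ℕ, μ.real (box x (-M) (k + 1)) =
      stepRatio μ (translate k x) (M + k) * μ.real (box x (-M) k) := by
    intro x hx M k
    have := h.measureReal_box_succ hx (-M) (M + k)
    rwa [show -(M : ℤ) + ((M + k : ℕ) : ℤ) = k by push_cast; ring] at this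
  have hlow : ∀ x ∈ TMC E, ∀ M k : ℕ, 1 ≤ M →
      δ ^ k * μ.real (box x (-M) 0) ≤ μ.real (box x (-M) k) := by
    intro x hx M k hM
    induction k with
    | zero => simp
    | succ k ih =>
      push_cast
      rw [hsucc x hx, pow_succ', mul_assoc]
      exact mul_le_mul (hδx _ (translate_mem_TMC hx _) _ (by omega)) ih (by positivity)
        (stepRatio_nonneg _ _ _)
  have hprod : ∀ x ∈ TMC E, ∀ y ∈ TMC E, (∀ i, i ∉ Set.Ico (0 : ℤ) l → y i = x i) →
      ∀ M j : ℕ, 1 ≤ M → μ.real (box y (-M) (l + 1 + j)) ≤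
        (δ ^ (l + 1))⁻¹ * (∏ i ∈ Finset.range j, (1 + γ (i + 1))) *
          μ.real (box x (-M) (l + 1 + j)) := by
    intro x hx y hy hxy M j hM
    induction j with
    | zero =>
      simp only [Finset.range_zero, Finset.prod_empty, mul_one, Nat.cast_zero, add_zero]
      rw [le_inv_mul_iff₀ (by positivity)]
      have h1 := hlow x hx M (l + 1) hM
      push_cast at h1
      refine le_trans (mul_le_mul_of_nonneg_left ?_ (by positivity)) h1
      rw [box_congr (x := x) (y := y) fun i hi => (hxy i fun hi' => by
        have := hi.2
        have := hi'.1
        omega).symm]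
      exact measureReal_mono (box_anti y le_rfl (by omega))
    | succ j ih =>
      have e1 : ((l : ℤ) + 1 + ((j + 1 : ℕ) : ℤ)) = ((l + 1 + j : ℕ) : ℤ) + 1 := by
        push_cast
        ring
      have e2 : ((l : ℤ) + 1 + (j : ℤ)) = ((l + 1 + j : ℕ) : ℤ) := by push_cast; ring
      rw [e2] at ih
      rw [e1, hsucc x hx, hsucc y hy, Finset.prod_range_succ]
      have h2 := hd _ (translate_mem_TMC hy ((l + 1 + j : ℕ) : ℤ)) _
        (translate_mem_TMC hx ((l + 1 + j : ℕ) : ℤ)) (j + 1) (M + (l + 1 + j)) (M + (l + 1 + j))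
        (by omega) (by omega) (by omega) fun i hi => hxy _ fun hi' => by
          have := hi.1
          have := hi'.2
          push_cast at *
          omega
      calc _ ≤ _ := mul_le_mul h2 ih measureReal_nonneg
            (mul_nonneg (by linarith [hγ (j + 1)]) (stepRatio_nonneg _ _ _))
        _ = _ := by ring
  refine ⟨(δ ^ (l + 1))⁻¹ * Real.exp (∑' i, γ (i + 1)), by positivity, ?_⟩
  intro x hx y hy hxy M j hM
  refine (hprod x hx y hy hxy M j hM).trans ?_
  gcongr
  calc ∏ i ∈ Finset.range j, (1 + γ (i + 1)) ≤ ∏ i ∈ Finset.range j, Real.exp (γ (i + 1)) := by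
        refine Finset.prod_le_prod (fun i _ => by linarith [hγ (i + 1)]) fun i _ => ?_
        rw [add_comm]
        exact Real.add_one_le_exp _
    _ = Real.exp (∑ i ∈ Finset.range j, γ (i + 1)) := (Real.exp_sum _ _).symm
    _ ≤ _ := Real.exp_le_exp.2 (((summable_nat_add_iff 1).2 hγs).sum_le_tsum _ fun i _ => hγ _)

end Distortion

section QuasiInvariance

variable {A : Type*} {E : Set (A × A)}

/-- The map that applies the permutation `π i` to the letter at `i`. -/
def letterwise (π : ℤ → Equiv.Perm A) (x : ℤ → A) : ℤ → A := fun i => π i (x i)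

@[simp] lemma letterwise_apply (π : ℤ → Equiv.Perm A) (x : ℤ → A) (i : ℤ) :
    letterwise π x i = π i (x i) := rfl

lemma exists_Ico_of_finset (I : Finset ℤ) (l : ℕ) :
    ∃ M j : ℕ, 1 ≤ M ∧ ∀ i ∈ I, i ∈ Set.Ico (-(M : ℤ)) (l + 1 + j) := by
  refine ⟨∑ i ∈ I, i.natAbs + 1, ∑ i ∈ I, i.natAbs, by omega, fun i hi => ?_⟩
  have := Finset.single_le_sum (f := fun i : ℤ => i.natAbs) (fun _ _ => Nat.zero_le _) hi
  rw [Set.mem_Ico, Nat.cast_add]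
  constructor <;> omega

variable [MeasurableSpace A] [MeasurableSingletonClass A] [Finite A]

lemma measurable_letterwise (π : ℤ → Equiv.Perm A) : Measurable (letterwise π) :=
  measurable_pi_lambda _ fun i => (measurable_of_finite (π i)).comp (measurable_pi_apply i)

variable {μ : Measure (ℤ → A)}

lemma GoodMeasure.exists_measure_preimage_le_of_cylinder (h : GoodMeasure E μ) (hc : CCSD E μ)
    {π : ℤ → Equiv.Perm A} (hπE : ∀ x ∈ TMC E, letterwise π x ∈ TMC E) {l : ℕ}
    (hπ : ∀ i, i ∉ Set.Ico (0 : ℤ) l → π i = 1) :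
    ∃ C : ℝ, 0 < C ∧ ∀ S ∈ measurableCylinders fun _ : ℤ => A,
      μ.real (letterwise π ⁻¹' S) ≤ C * μ.real S := by
  have := h.1
  obtain ⟨C, hC, hb⟩ := h.exists_measureReal_box_le hc l
  refine ⟨C, hC, fun S hS => ?_⟩
  obtain ⟨I, S', hS', rfl⟩ := (mem_measurableCylinders _).1 hS
  obtain ⟨M, j, hM, hI⟩ := exists_Ico_of_finset I l
  set J : Finset ℤ := Finset.Ico (-(M : ℤ)) (l + 1 + j) with hJ
  set r : (ℤ → A) → (J → A) := fun x i => x i with hr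
  have hrm : Measurable r := measurable_pi_lambda _ fun i => measurable_pi_apply (i : ℤ)
  have := Fintype.ofFinite (J → A)
  classical
  set s : Finset (J → A) := Finset.univ.filter fun w => ∃ x ∈ cylinder I S', r x = w with hs
  have hcyl : cylinder I S' = r ⁻¹' (s : Set (J → A)) := by
    ext x
    simp only [hs, Finset.coe_filter, Finset.mem_univ, true_and, Set.mem_preimage,
      Set.mem_ofPred_eq]
    refine ⟨fun hx => ⟨x, hx, rfl⟩, ?_⟩
    rintro ⟨y, hy, hyx⟩
    rw [mem_cylinder] at hy ⊢
    convert hy using 1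
    ext i
    exact (congrFun hyx ⟨i, by simpa [hJ] using hI i i.2⟩).symm
  have hsum : ∀ f : (ℤ → A) → (J → A), Measurable f →
      μ.real (f ⁻¹' (s : Set (J → A))) = ∑ w ∈ s, μ.real (f ⁻¹' {w}) := by
    intro f hf
    rw [measureReal_def, ← sum_measure_preimage_singleton s fun w _ => hf (measurableSet_singleton w),
      ENNReal.toReal_sum fun c _ => measure_ne_top _ _]
    rfl
  rw [hcyl, ← Set.preimage_comp, hsum _ hrm, hsum _ (hrm.comp (measurable_letterwise π)),
    Finset.mul_sum]
  refine Finset.sum_le_sum fun w _ => ?_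
  by_cases h0 : μ (r ∘ letterwise π ⁻¹' {w}) = 0
  · rw [measureReal_def, h0]
    positivity
  obtain ⟨x, hxw, hx⟩ := h.exists_mem_box h0
  have hxw' : ∀ i ∈ Set.Ico (-(M : ℤ)) (l + 1 + j), ∀ hi : i ∈ J, π i (x i) = w ⟨i, hi⟩ :=
    fun i _ hi => congrFun hxw ⟨i, hi⟩
  have e1 : r ∘ letterwise π ⁻¹' {w} = box x (-M) (l + 1 + j) := by
    ext z
    simp only [Set.mem_preimage, Set.mem_singleton_iff, Function.comp, box, Set.mem_ofPred_eq]
    rw [← show (r ∘ letterwise π) x = w from hxw]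
    constructor
    · intro hz i hi
      exact (π i).injective (congrFun hz ⟨i, by simpa [hJ] using hi⟩)
    · intro hz
      ext i
      exact congrArg (π i) (hz i (Finset.mem_Ico.1 i.2))
  have e2 : r ⁻¹' {w} = box (letterwise π x) (-M) (l + 1 + j) := by
    ext z
    simp only [Set.mem_preimage, Set.mem_singleton_iff, box, Set.mem_ofPred_eq]
    rw [← show (r ∘ letterwise π) x = w from hxw]
    constructor
    · intro hz i hi
      exact congrFun hz ⟨i, by simpa [hJ] using hi⟩
    · intro hz
      ext i
      exact hz i (Finset.mem_Ico.1 i.2)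
  rw [e1, e2]
  refine hb _ (hπE x hx) _ hx (fun i hi => ?_) M j hM
  simp [hπ i hi]

lemma GoodMeasure.exists_measure_preimage_le (h : GoodMeasure E μ) (hc : CCSD E μ)
    {π : ℤ → Equiv.Perm A} (hπE : ∀ x ∈ TMC E, letterwise π x ∈ TMC E) {l : ℕ}
    (hπ : ∀ i, i ∉ Set.Ico (0 : ℤ) l → π i = 1) :
    ∃ C : ℝ, 0 < C ∧ ∀ S, MeasurableSet S → μ.real (letterwise π ⁻¹' S) ≤ C * μ.real S := by
  have := h.1
  obtain ⟨C, hC, hb⟩ := h.exists_measure_preimage_le_of_cylinder hc hπE hπ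
  refine ⟨C, hC, fun S hS => ?_⟩
  have hm := measurable_letterwise π
  have := Measure.isProbabilityMeasure_map (μ := μ) hm.aemeasurable
  have hd := Measure.MeasureDense.of_generateFrom_isSetAlgebra_finite (μ := μ + μ.map (letterwise π))
    isSetAlgebra_measurableCylinders (generateFrom_measurableCylinders (α := fun _ : ℤ => A)).symm
  have hmap : ∀ S, MeasurableSet S →
      (μ.map (letterwise π)).real S = μ.real (letterwise π ⁻¹' S) :=
    fun S hS => map_measureReal_apply hm hS
  rw [← hmap S hS]
  refine le_of_forall_pos_le_add fun ε hε => ?_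
  obtain ⟨t, ht, hlt⟩ := hd.approx S hS (measure_ne_top _ _) (ε / (1 + C)) (by positivity)
  have htm := hd.measurable t ht
  have hlt' : μ.real (symmDiff S t) + (μ.map (letterwise π)).real (symmDiff S t) < ε / (1 + C) := by
    rw [← measureReal_add_apply, measureReal_def]
    exact (ENNReal.toReal_lt_of_lt_ofReal hlt)
  have hle : ∀ (ν : Measure (ℤ → A)) [IsFiniteMeasure ν] (S t : Set (ℤ → A)),
      ν.real S ≤ ν.real t + ν.real (symmDiff S t) := by
    intro ν _ S t
    refine (measureReal_mono ?_).trans (measureReal_union_le t (symmDiff S t))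
    intro z hz
    by_cases hzt : z ∈ t
    · exact Or.inl hzt
    · exact Or.inr (Or.inl ⟨hz, hzt⟩)
  have h1 := hle (μ.map (letterwise π)) S t
  have h2 := hle μ t S
  rw [symmDiff_comm] at h2
  have h3 := hb t ht
  rw [← hmap t htm] at h3
  have h4 : 0 ≤ μ.real (symmDiff S t) := measureReal_nonneg
  have h5 : 0 ≤ (μ.map (letterwise π)).real (symmDiff S t) := measureReal_nonneg
  have h6 : C * μ.real t ≤ C * (μ.real S + μ.real (symmDiff S t)) :=
    mul_le_mul_of_nonneg_left h2 hC.le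
  have h7 : (1 + C) * (μ.real (symmDiff S t) + (μ.map (letterwise π)).real (symmDiff S t)) ≤ ε := by
    rw [lt_div_iff₀' (by positivity)] at hlt'
    exact hlt'.le
  nlinarith [mul_nonneg hC.le h5]

/-- A bounded density for the image of `μ` under a compactly supported letterwise map. -/
lemma GoodMeasure.exists_density (h : GoodMeasure E μ) (hc : CCSD E μ)
    {π : ℤ → Equiv.Perm A} (hπE : ∀ x ∈ TMC E, letterwise π x ∈ TMC E) {l : ℕ}
    (hπ : ∀ i, i ∉ Set.Ico (0 : ℤ) l → π i = 1) :
    ∃ (ρ : (ℤ → A) → ℝ) (C : ℝ), Measurable ρ ∧ (∀ x, |ρ x| ≤ C) ∧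
      ∀ u : (ℤ → A) → ℂ, Measurable u → ∫ x, u (letterwise π x) ∂μ = ∫ x, (ρ x : ℂ) * u x ∂μ := by
  have := h.1
  obtain ⟨C, hC, hb⟩ := h.exists_measure_preimage_le hc hπE hπ
  have hm := measurable_letterwise π
  have := Measure.isProbabilityMeasure_map (μ := μ) hm.aemeasurable
  set ν := μ.map (letterwise π) with hν
  have hle : ∀ S, MeasurableSet S → ν S ≤ ENNReal.ofReal C * μ S := by
    intro S hS
    have := hb S hS
    rw [← map_measureReal_apply hm hS] at this
    rw [← ENNReal.ofReal_toReal (measure_ne_top ν S), ← ENNReal.ofReal_toReal (measure_ne_top μ S),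
      ← ENNReal.ofReal_mul hC.le]
    exact ENNReal.ofReal_le_ofReal this
  have hac : ν ≪ μ := Measure.AbsolutelyContinuous.mk fun S hS h0 => by
    have := hle S hS
    rw [h0, mul_zero] at this
    exact le_antisymm this zero_le
  have hbound : ν.rnDeriv μ ≤ᵐ[μ] fun _ => ENNReal.ofReal C := by
    refine ae_le_of_forall_setLIntegral_le_of_sigmaFinite (ν.measurable_rnDeriv μ) fun S hS _ => ?_
    rw [setLIntegral_const]
    exact (Measure.setLIntegral_rnDeriv_le S).trans (hle S hS)
  refine ⟨fun x => min (ν.rnDeriv μ x).toReal C, C,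
    (ν.measurable_rnDeriv μ).ennreal_toReal.min measurable_const, fun x => ?_, fun u hu => ?_⟩
  · rw [abs_of_nonneg (le_min ENNReal.toReal_nonneg hC.le)]
    exact min_le_right _ _
  · rw [← integral_map hm.aemeasurable hu.aestronglyMeasurable, ← hν, ← integral_rnDeriv_smul hac]
    refine integral_congr_ae ?_
    filter_upwards [hbound] with x hx
    rw [min_eq_left (ENNReal.toReal_le_of_le_ofReal hC.le hx), Complex.real_smul]

end QuasiInvariance

lemma integral_comp_translate {A : Type*} [MeasurableSpace A] {μ : Measure (ℤ → A)}
    (h : Measure.map shiftMap μ = μ) {F : Type*} [NormedAddCommGroup F] [NormedSpace ℝ F]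
    {f : (ℤ → A) → F} (hf : AEStronglyMeasurable f μ) (t : ℤ) :
    ∫ x, f (translate t x) ∂μ = ∫ x, f x ∂μ := by
  have hmp := measurePreserving_translate h t
  conv_rhs => rw [← hmp.map_eq]
  rw [integral_map hmp.measurable.aemeasurable (by rwa [hmp.map_eq])]

lemma sum_sum_abs_le {c : ℤ → ℝ} {M δ : ℝ} {L : ℕ} (hM : ∀ t, |c t| ≤ M)
    (hL : ∀ t : ℤ, (L : ℤ) < |t| → |c t| ≤ δ) (hδ : 0 ≤ δ) (J : Finset ℤ) :
    ∑ t ∈ J, ∑ s ∈ J, |c (s - t)| ≤ J.card * (J.card * δ + (2 * L + 1) * M) := by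
  have hM0 : 0 ≤ M := (abs_nonneg _).trans (hM 0)
  rw [← nsmul_eq_mul]
  refine Finset.sum_le_card_nsmul _ _ _ fun t _ => ?_
  calc ∑ s ∈ J, |c (s - t)| ≤ ∑ s ∈ J, (δ + if s ∈ Finset.Icc (t - L) (t + L) then M else 0) := by
        refine Finset.sum_le_sum fun s _ => ?_
        split_ifs with h
        · linarith [hM (s - t)]
        · rw [add_zero]
          refine hL _ (lt_abs.2 ?_)
          rw [Finset.mem_Icc] at h
          omega
    _ = J.card * δ + ∑ s ∈ J.filter (· ∈ Finset.Icc (t - L) (t + L)), M := by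
        rw [Finset.sum_add_distrib, Finset.sum_const, nsmul_eq_mul, Finset.sum_filter]
    _ ≤ _ := by
        rw [Finset.sum_const, nsmul_eq_mul]
        gcongr
        have h1 : (J.filter (· ∈ Finset.Icc (t - (L : ℤ)) (t + L))).card ≤ 2 * L + 1 := by
          refine (Finset.card_le_card (t := Finset.Icc (t - (L : ℤ)) (t + L)) fun s hs =>
            (Finset.mem_filter.1 hs).2).trans (le_of_eq ?_)
          rw [Int.card_Icc]
          omega
        exact_mod_cast h1

lemma exists_norm_inv_sub_one_le {d : ℕ} (hd : 0 < d) :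
    ∃ R : ℝ, 0 < R ∧ ∀ ω : ℂ, ω ^ d = 1 → ‖(ω - 1)⁻¹‖ ≤ R := by
  have hfin : {ω : ℂ | ω ^ d = 1}.Finite := by
    refine (Polynomial.nthRootsFinset d (1 : ℂ)).finite_toSet.subset fun ω hω => ?_
    exact (Polynomial.mem_nthRootsFinset hd 1).2 hω
  obtain ⟨R, hR⟩ := (hfin.image fun ω => ‖(ω - 1)⁻¹‖).bddAbove
  exact ⟨max R 1, by positivity, fun ω hω =>
    (hR ⟨ω, hω, rfl⟩).trans (le_max_left _ _)⟩

lemma integral_normSq_sum_le {A : Type*} [MeasurableSpace A] {μ : Measure (ℤ → A)}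
    [IsFiniteMeasure μ] {ψ : ℤ → (ℤ → A) → ℝ} {C : ℝ}
    (hψ : ∀ t, Measurable (ψ t)) (hC : ∀ t x, |ψ t x| ≤ C) (a : ℤ → ℂ) {R : ℝ}
    (J : Finset ℤ) (hR : ∀ t ∈ J, ‖a t‖ ≤ R) :
    ∫ x, ‖∑ t ∈ J, a t * (ψ t x : ℂ)‖ ^ 2 ∂μ ≤
      R ^ 2 * ∑ t ∈ J, ∑ s ∈ J, |∫ x, ψ t x * ψ s x ∂μ| := by
  have hintg : ∀ t s, Integrable (fun x => ψ t x * ψ s x) μ := fun t s =>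
    Integrable.of_bound ((hψ t).mul (hψ s)).aestronglyMeasurable (C * C) (ae_of_all _ fun x => by
      rw [norm_mul]
      exact mul_le_mul (hC t x) (hC s x) (norm_nonneg _) ((abs_nonneg _).trans (hC t x)))
  have hpt : ∀ x, ‖∑ t ∈ J, a t * (ψ t x : ℂ)‖ ^ 2 =
      ∑ t ∈ J, ∑ s ∈ J, (a t * starRingEnd ℂ (a s)).re * (ψ t x * ψ s x) := by
    intro x
    have h1 : ((‖∑ t ∈ J, a t * (ψ t x : ℂ)‖ ^ 2 : ℝ) : ℂ) =
        ∑ t ∈ J, ∑ s ∈ J, (a t * starRingEnd ℂ (a s)) * ((ψ t x * ψ s x : ℝ) : ℂ) := by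
      rw [Complex.ofReal_pow, ← Complex.mul_conj', map_sum, Finset.sum_mul_sum]
      refine Finset.sum_congr rfl fun t _ => Finset.sum_congr rfl fun s _ => ?_
      rw [map_mul, Complex.conj_ofReal]
      push_cast
      ring
    have h2 := congrArg Complex.re h1
    rw [Complex.ofReal_re] at h2
    rw [h2, Complex.re_sum]
    refine Finset.sum_congr rfl fun t _ => ?_
    rw [Complex.re_sum]
    exact Finset.sum_congr rfl fun s _ => Complex.re_mul_ofReal _ _
  simp only [hpt]
  rw [integral_finsetSum _ fun t _ => integrable_finsetSum _ fun s _ => (hintg t s).const_mul _,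
    Finset.mul_sum]
  refine Finset.sum_le_sum fun t ht => ?_
  rw [integral_finsetSum _ fun s _ => (hintg t s).const_mul _, Finset.mul_sum]
  refine Finset.sum_le_sum fun s hs => ?_
  rw [integral_const_mul]
  refine (le_abs_self _).trans ?_
  rw [abs_mul]
  refine mul_le_mul_of_nonneg_right ((Complex.abs_re_le_norm _).trans ?_) (abs_nonneg _)
  rw [norm_mul, RCLike.norm_conj, sq]
  exact mul_le_mul (hR t ht) (hR s hs) (norm_nonneg _) ((norm_nonneg _).trans (hR t ht))

section Decoupling

variable {A : Type*} {E : Set (A × A)} [TopologicalSpace A] [DiscreteTopology A]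
  [MeasurableSpace A] [MeasurableSingletonClass A] [Finite A] {μ : Measure (ℤ → A)}

lemma exists_dependsOn_integral_sub_le [IsFiniteMeasure μ] {ρ : (ℤ → A) → ℝ}
    (hρ : Integrable ρ μ) {ε : ℝ} (hε : 0 < ε) :
    ∃ (w : C(ℤ → A, ℝ)) (W : ℕ), DependsOn w (Set.Icc (-(W : ℤ)) W) ∧ ∫ x, |ρ x - w x| ∂μ ≤ ε := by
  obtain ⟨g, hg, hgi⟩ := hρ.exists_boundedContinuous_integral_sub_le (half_pos hε)
  have hμ : 0 ≤ μ.real Set.univ := measureReal_nonneg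
  obtain ⟨w, W, hw, hgw⟩ := exists_dependsOn_near g.toContinuousMap
    (show 0 < ε / (2 * (μ.real Set.univ + 1)) by positivity)
  refine ⟨w, W, hw, ?_⟩
  have hwi : Integrable w μ := integrable_of_dependsOn (Set.finite_Icc _ _) hw
  have h1 : ∫ x, |g x - w x| ∂μ ≤ ε / 2 := by
    have := norm_integral_le_of_norm_le_const (μ := μ) (C := ε / (2 * (μ.real Set.univ + 1)))
      (f := fun x => |g x - w x|) (ae_of_all _ fun x => by simpa using hgw x)
    refine (le_abs_self _).trans (this.trans ?_)
    rw [div_mul_eq_mul_div, div_le_div_iff₀ (by positivity) (by positivity)]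
    nlinarith
  calc ∫ x, |ρ x - w x| ∂μ ≤ ∫ x, (‖ρ x - g x‖ + |g x - w x|) ∂μ := by
        refine integral_mono (hρ.sub hwi).abs ((hρ.sub hgi).norm.add (hgi.sub hwi).abs) fun x => ?_
        exact abs_sub_le _ _ _
    _ = ∫ x, ‖ρ x - g x‖ ∂μ + ∫ x, |g x - w x| ∂μ :=
        integral_add (hρ.sub hgi).norm (hgi.sub hwi).abs
    _ ≤ ε := by linarith

/-- The density of a compactly supported letterwise map decorrelates from its far translates. -/
lemma GoodMeasure.correlation_le (h : GoodMeasure E μ) {π : ℤ → Equiv.Perm A} {l : ℕ}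
    (hπ : ∀ i, i ∉ Set.Ico (0 : ℤ) l → π i = 1) {ρ : (ℤ → A) → ℝ} {C : ℝ} (hρ : Measurable ρ)
    (hC : ∀ x, |ρ x| ≤ C) (hu : ∀ u : (ℤ → A) → ℂ, Measurable u →
      ∫ x, u (letterwise π x) ∂μ = ∫ x, (ρ x : ℂ) * u x ∂μ) {ε : ℝ} (hε : 0 < ε) :
    ∃ L : ℕ, ∀ t : ℤ, (L : ℤ) < |t| → |∫ x, ρ x * ρ (translate t x) ∂μ - 1| ≤ ε := by
  have := h.1
  have hur : ∀ u : (ℤ → A) → ℝ, Measurable u →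
      ∫ x, u (letterwise π x) ∂μ = ∫ x, ρ x * u x ∂μ := by
    intro u hum
    have := hu (fun x => (u x : ℂ)) (Complex.measurable_ofReal.comp hum)
    simp only [← Complex.ofReal_mul] at this
    rw [integral_complex_ofReal, integral_complex_ofReal] at this
    exact_mod_cast this
  have hρ1 : ∫ x, ρ x ∂μ = 1 := by
    have := hur (fun _ => 1) measurable_const
    simpa using this.symm
  have hρi : Integrable ρ μ := Integrable.of_bound hρ.aestronglyMeasurable C (ae_of_all _ hC)
  have hC0 : 0 ≤ C := by
    have : Nonempty (ℤ → A) := by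
      by_contra hne
      rw [not_nonempty_iff] at hne
      exact (IsProbabilityMeasure.ne_zero μ) (Measure.eq_zero_of_isEmpty μ)
    exact (abs_nonneg _).trans (hC this.some)
  obtain ⟨w, W, hw, hρw⟩ := exists_dependsOn_integral_sub_le hρi
    (show 0 < ε / (1 + C) by positivity)
  have hwi : Integrable w μ := integrable_of_dependsOn (Set.finite_Icc _ _) hw
  have hwm : Measurable w := w.continuous.measurable
  refine ⟨W + l, fun t ht => ?_⟩
  have hmp := measurePreserving_translate h.2.1 t
  have hwt : ∫ x, ρ x * w (translate t x) ∂μ = ∫ x, w x ∂μ := by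
    rw [← hur (fun x => w (translate t x)) (hwm.comp (measurable_translate t))]
    rw [← integral_comp_translate h.2.1 hwm.aestronglyMeasurable t]
    refine integral_congr_ae (ae_of_all _ fun x => hw fun i hi => ?_)
    have : i + t ∉ Set.Ico (0 : ℤ) l := by
      simp only [Set.mem_Icc, Set.mem_Ico] at hi ⊢
      rcases lt_abs.1 ht with h1 | h1 <;> push_cast at h1 <;> omega
    simp [hπ _ this]
  have h1 : |∫ x, w x ∂μ - 1| ≤ ε / (1 + C) := by
    have : ∫ x, w x ∂μ - 1 = ∫ x, (w x - ρ x) ∂μ := by rw [integral_sub hwi hρi, hρ1]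
    rw [this]
    refine (abs_integral_le_integral_abs).trans (le_trans (le_of_eq ?_) hρw)
    exact integral_congr_ae (ae_of_all _ fun x => abs_sub_comm _ _)
  have hρti : Integrable (fun x => ρ (translate t x)) μ := hmp.integrable_comp_of_integrable hρi
  have hwti : Integrable (fun x => w (translate t x)) μ := hmp.integrable_comp_of_integrable hwi
  have hb : ∀ {v : (ℤ → A) → ℝ}, Integrable v μ → Integrable (fun x => ρ x * v x) μ := fun hv =>
    hv.bdd_mul hρ.aestronglyMeasurable (ae_of_all _ hC)
  have h2 : |∫ x, ρ x * ρ (translate t x) ∂μ - ∫ x, ρ x * w (translate t x) ∂μ| ≤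
      C * (ε / (1 + C)) := by
    rw [← integral_sub (hb hρti) (hb hwti)]
    calc _ ≤ ∫ x, |ρ x * ρ (translate t x) - ρ x * w (translate t x)| ∂μ :=
          abs_integral_le_integral_abs
      _ ≤ ∫ x, C * |ρ (translate t x) - w (translate t x)| ∂μ := by
          refine integral_mono ((hb hρti).sub (hb hwti)).abs
            ((hρti.sub hwti).abs.const_mul C) fun x => ?_
          simp only
          rw [← mul_sub, abs_mul]
          exact mul_le_mul_of_nonneg_right (hC x) (abs_nonneg _)
      _ = C * ∫ x, |ρ x - w x| ∂μ := by
          rw [integral_const_mul]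
          congr 1
          exact integral_comp_translate h.2.1 (f := fun x => |ρ x - w x|)
            (hρ.sub hwm).abs.aestronglyMeasurable t
      _ ≤ _ := mul_le_mul_of_nonneg_left hρw hC0
  rw [hwt] at h2
  have h3 : C * (ε / (1 + C)) + ε / (1 + C) = ε := by
    field_simp
    ring
  rw [abs_le] at *
  constructor <;> linarith [h1.1, h1.2, h2.1, h2.2]

/-- A bounded function that is multiplied by nontrivial roots of unity under many translates of a
letterwise map has small integral. -/
lemma GoodMeasure.decoupling (h : GoodMeasure E μ) (hc : CCSD E μ) {π : ℤ → Equiv.Perm A}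
    (hπE : ∀ x ∈ TMC E, letterwise π x ∈ TMC E) {l : ℕ}
    (hπ : ∀ i, i ∉ Set.Ico (0 : ℤ) l → π i = 1) {d : ℕ} (hd : 0 < d) {ε : ℝ} (hε : 0 < ε) :
    ∃ m₀ : ℕ, ∀ J : Finset ℤ, m₀ ≤ J.card → ∀ u : (ℤ → A) → ℂ, Measurable u → (∀ x, ‖u x‖ ≤ 1) →
      ∀ ω : ℤ → ℂ, (∀ t ∈ J, ω t ^ d = 1 ∧ ω t ≠ 1) →
        (∀ t ∈ J, ∀ x, u (translate (-t) (letterwise π (translate t x))) = ω t * u x) →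
          ‖∫ x, u x ∂μ‖ ≤ ε := by
  have := h.1
  obtain ⟨ρ, C, hρ, hC, hu⟩ := h.exists_density hc hπE hπ
  obtain ⟨R, hR, hRω⟩ := exists_norm_inv_sub_one_le hd
  set δ : ℝ := ε ^ 2 / (2 * R ^ 2) with hδ
  have hδ0 : 0 < δ := by positivity
  obtain ⟨L, hL⟩ := h.correlation_le hπ hρ hC hu hδ0
  set ψ : ℤ → (ℤ → A) → ℝ := fun t x => ρ (translate t x) - 1 with hψ
  have hψm : ∀ t, Measurable (ψ t) := fun t => (hρ.comp (measurable_translate t)).sub_const 1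
  have hψC : ∀ t x, |ψ t x| ≤ C + 1 := fun t x =>
    (abs_sub _ _).trans (by simpa using hC (translate t x))
  set c : ℤ → ℝ := fun t => ∫ x, ρ x * ρ (translate t x) ∂μ - 1 with hc'
  have hρ1 : ∫ x, ρ x ∂μ = 1 := by
    have := hu (fun _ => 1) measurable_const
    simp only [mul_one] at this
    rw [integral_complex_ofReal] at this
    simpa using this.symm
  have hρt : ∀ t, Integrable (fun x => ρ (translate t x)) μ := fun t =>
    Integrable.of_bound (hρ.comp (measurable_translate t)).aestronglyMeasurable C
      (ae_of_all _ fun x => hC _)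
  have hρρ : ∀ t s, Integrable (fun x => ρ (translate t x) * ρ (translate s x)) μ := fun t s =>
    (hρt s).bdd_mul (hρ.comp (measurable_translate t)).aestronglyMeasurable
      (ae_of_all _ fun x => hC _)
  have hρt1 : ∀ t, ∫ x, ρ (translate t x) ∂μ = 1 := fun t => by
    rw [integral_comp_translate h.2.1 hρ.aestronglyMeasurable, hρ1]
  have hψψ : ∀ t s, ∫ x, ψ t x * ψ s x ∂μ = c (s - t) := by
    intro t s
    have h1 : ∫ x, ρ (translate t x) * ρ (translate s x) ∂μ = c (s - t) + 1 := by
      rw [hc', sub_add_cancel, ← integral_comp_translate h.2.1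
        (f := fun x => ρ x * ρ (translate (s - t) x))
        (hρ.mul (hρ.comp (measurable_translate (s - t)))).aestronglyMeasurable t]
      simp [translate_translate]
    have h2 : ∀ x, ψ t x * ψ s x = ρ (translate t x) * ρ (translate s x) -
        ρ (translate t x) - ρ (translate s x) + 1 := fun x => by
      simp only [hψ]
      ring
    simp only [h2]
    have i1 : Integrable (fun x => ρ (translate t x) * ρ (translate s x) - ρ (translate t x)) μ :=
      (hρρ t s).sub (hρt t)
    have i2 : Integrable (fun x => ρ (translate t x) * ρ (translate s x) - ρ (translate t x) -
        ρ (translate s x)) μ := i1.sub (hρt s)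
    rw [integral_add i2 (integrable_const _), integral_sub i1 (hρt s),
      integral_sub (hρρ t s) (hρt t), h1, hρt1, hρt1]
    simp
  have hcM : ∀ t, |c t| ≤ (C + 1) * (C + 1) := by
    intro t
    have h0 := hψψ 0 t
    rw [sub_zero] at h0
    rw [← h0]
    have := norm_integral_le_of_norm_le_const (μ := μ) (C := (C + 1) * (C + 1))
      (f := fun x => ψ 0 x * ψ t x) (ae_of_all _ fun x => by
        rw [norm_mul]
        exact mul_le_mul (hψC 0 x) (hψC t x) (norm_nonneg _) ((abs_nonneg _).trans (hψC 0 x)))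
    simpa using this
  set M := (C + 1) * (C + 1) with hM
  obtain ⟨m₀, hm₀⟩ := exists_nat_ge (2 * R ^ 2 * ((2 * L + 1) * M) / ε ^ 2)
  refine ⟨m₀ + 1, fun J hJ u hum hu1 ω hω huω => ?_⟩
  set m : ℝ := (J.card : ℝ) with hm
  have hm0 : 0 < m := by
    rw [hm]
    exact_mod_cast (by omega : 0 < J.card)
  have hmm : 2 * R ^ 2 * ((2 * L + 1) * M) ≤ m * ε ^ 2 := by
    rw [div_le_iff₀ (by positivity)] at hm₀
    refine hm₀.trans (mul_le_mul_of_nonneg_right ?_ (by positivity))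
    rw [hm]
    exact_mod_cast (by omega : m₀ ≤ J.card)
  set a : ℤ → ℂ := fun t => (ω t - 1)⁻¹ with ha
  set Y : (ℤ → A) → ℂ := fun x => ∑ t ∈ J, a t * (ψ t x : ℂ) with hY
  have hV : ∫ x, ‖Y x‖ ^ 2 ∂μ ≤ m ^ 2 * ε ^ 2 := by
    refine (integral_normSq_sum_le hψm hψC a J fun t ht => hRω _ (hω t ht).1).trans ?_
    simp only [hψψ]
    have h1 := sum_sum_abs_le hcM hL hδ0.le J
    have h2 : R ^ 2 * δ = ε ^ 2 / 2 := by
      rw [hδ]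
      field_simp
    calc R ^ 2 * ∑ t ∈ J, ∑ s ∈ J, |c (s - t)|
        ≤ R ^ 2 * (m * (m * δ + (2 * L + 1) * M)) := mul_le_mul_of_nonneg_left h1 (by positivity)
      _ = m * (m * (R ^ 2 * δ) + R ^ 2 * ((2 * L + 1) * M)) := by ring
      _ ≤ m * (m * (ε ^ 2 / 2) + m * ε ^ 2 / 2) := by
        rw [h2]
        gcongr
        linarith
      _ = _ := by ring
  have hYm : Measurable Y := Finset.measurable_sum _ fun t _ =>
    (Complex.measurable_ofReal.comp (hψm t)).const_mul _
  have hYb : ∃ K, ∀ x, ‖Y x‖ ≤ K := by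
    refine ⟨∑ t ∈ J, ‖a t‖ * (C + 1), fun x => (norm_sum_le _ _).trans ?_⟩
    refine Finset.sum_le_sum fun t _ => ?_
    rw [norm_mul, Complex.norm_real]
    exact mul_le_mul_of_nonneg_left (hψC t x) (norm_nonneg _)
  obtain ⟨K, hK⟩ := hYb
  have hui : Integrable u μ := Integrable.of_bound hum.aestronglyMeasurable 1 (ae_of_all _ hu1)
  have hψu : ∀ t, Integrable (fun x => (ψ t x : ℂ) * u x) μ := fun t =>
    hui.bdd_mul (c := C + 1) (Complex.measurable_ofReal.comp (hψm t)).aestronglyMeasurable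
      (ae_of_all _ fun x => by
        rw [Complex.norm_real]
        exact hψC t x)
  have hρu : ∀ t, Integrable (fun x => (ρ (translate t x) : ℂ) * u x) μ := fun t =>
    hui.bdd_mul (c := C) (Complex.measurable_ofReal.comp
      (hρ.comp (measurable_translate t))).aestronglyMeasurable
      (ae_of_all _ fun x => by
        rw [Complex.norm_real]
        exact hC _)
  have hkey : ∀ t ∈ J, ∫ x, u x ∂μ = a t * ∫ x, (ψ t x : ℂ) * u x ∂μ := by
    intro t ht
    have hut : Measurable fun x => u (translate (-t) x) := hum.comp (measurable_translate _)
    have hρut : Measurable fun x => (ρ x : ℂ) * u (translate (-t) x) :=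
      (Complex.measurable_ofReal.comp hρ).mul hut
    have h1 := hu _ hut
    rw [← integral_comp_translate h.2.1
      (f := fun x => u (translate (-t) (letterwise π x)))
      (hut.comp (measurable_letterwise π)).aestronglyMeasurable t,
      ← integral_comp_translate h.2.1 hρut.aestronglyMeasurable t] at h1
    simp only [huω t ht, translate_translate, neg_add_cancel, translate_zero,
      integral_const_mul] at h1
    have h2 : ∫ x, (ψ t x : ℂ) * u x ∂μ = (ω t - 1) * ∫ x, u x ∂μ := by
      rw [sub_mul, one_mul, h1, ← integral_sub (hρu t) hui]
      refine integral_congr_ae (ae_of_all _ fun x => ?_)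
      simp only [hψ]
      push_cast
      ring
    rw [h2, ha, inv_mul_cancel_left₀ (sub_ne_zero.2 (hω t ht).2)]
  have hsum : (m : ℂ) * ∫ x, u x ∂μ = ∫ x, Y x * u x ∂μ := by
    have h1 : ∑ t ∈ J, ∫ x, u x ∂μ = ∑ t ∈ J, a t * ∫ x, (ψ t x : ℂ) * u x ∂μ :=
      Finset.sum_congr rfl hkey
    rw [Finset.sum_const, nsmul_eq_mul] at h1
    rw [hm, Complex.ofReal_natCast, h1]
    simp only [← integral_const_mul]
    rw [← integral_finsetSum _ fun t _ => (hψu t).const_mul _]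
    refine integral_congr_ae (ae_of_all _ fun x => ?_)
    simp only [hY, Finset.sum_mul, mul_assoc]
  have hYi : Integrable (fun x => ‖Y x‖) μ :=
    Integrable.of_bound hYm.norm.aestronglyMeasurable K (ae_of_all _ fun x => by
      rw [norm_norm]
      exact hK x)
  have hY2i : Integrable (fun x => ‖Y x‖ ^ 2) μ :=
    Integrable.of_bound (hYm.norm.pow_const 2).aestronglyMeasurable (K ^ 2)
      (ae_of_all _ fun x => by
        rw [norm_pow, norm_norm]
        exact pow_le_pow_left₀ (norm_nonneg _) (hK x) 2)
  have hmε : 0 < m * ε := mul_pos hm0 hε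
  have hbound : m * ‖∫ x, u x ∂μ‖ ≤ m * ε := by
    calc m * ‖∫ x, u x ∂μ‖ = ‖∫ x, Y x * u x ∂μ‖ := by
          rw [← hsum, norm_mul, Complex.norm_real, Real.norm_of_nonneg hm0.le]
      _ ≤ ∫ x, ‖Y x * u x‖ ∂μ := norm_integral_le_integral_norm _
      _ ≤ ∫ x, (m * ε / 2 + (2 * (m * ε))⁻¹ * ‖Y x‖ ^ 2) ∂μ := by
          refine integral_mono_of_nonneg (ae_of_all _ fun x => norm_nonneg _)
            ((integrable_const _).add (hY2i.const_mul _)) (ae_of_all _ fun x => ?_)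
          simp only [norm_mul]
          refine (mul_le_of_le_one_right (norm_nonneg _) (hu1 x)).trans ?_
          rw [← sub_nonneg]
          have : m * ε / 2 + (2 * (m * ε))⁻¹ * ‖Y x‖ ^ 2 - ‖Y x‖ =
              (2 * (m * ε))⁻¹ * (‖Y x‖ - m * ε) ^ 2 := by
            field_simp
            ring
          rw [this]
          positivity
      _ = m * ε / 2 + (2 * (m * ε))⁻¹ * ∫ x, ‖Y x‖ ^ 2 ∂μ := by
          rw [integral_add (integrable_const _) (hY2i.const_mul _), integral_const_mul]
          simp
      _ ≤ m * ε / 2 + (2 * (m * ε))⁻¹ * (m ^ 2 * ε ^ 2) := by gcongr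
      _ = m * ε := by
          field_simp
          ring
  exact le_of_mul_le_mul_left hbound hm0

end Decoupling

section Homoclinic

variable {K : Type*} [AddCommGroup K]

lemma CA_add_eq (x : ℤ → K) : CA (fun a b : K => a + b) x = x + translate 1 x := rfl

lemma translate_add (t : ℤ) (x y : ℤ → K) : translate t (x + y) = translate t x + translate t y :=
  rfl

lemma CA_add_iterate_add (n : ℕ) (x y : ℤ → K) : (CA (fun a b : K => a + b))^[n] (x + y) =
    (CA (fun a b : K => a + b))^[n] x + (CA (fun a b : K => a + b))^[n] y := by
  induction n generalizing x y with
  | zero => rfl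
  | succ n ih =>
    rw [Function.iterate_succ_apply, Function.iterate_succ_apply, Function.iterate_succ_apply, ← ih]
    congr 1
    simp only [CA_add_eq, translate_add]
    abel

lemma exists_stdAddChar_eq {p : ℕ} [NeZero p] {z : ℂ} (hz : z ^ p = 1) :
    ∃ e : ZMod p, ZMod.stdAddChar e = z := by
  obtain ⟨i, -, hi⟩ :=
    (Complex.isPrimitiveRoot_exp p (NeZero.ne p)).eq_pow_of_pow_eq_one hz
  refine ⟨((i : ℤ) : ZMod p), ?_⟩
  rw [ZMod.stdAddChar_coe, ← hi, ← Complex.exp_nat_mul]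
  congr 1
  push_cast
  ring

/-- A character of prime order, nontrivial on some translate of a finitely supported configuration
`h`, is nontrivial on many translates of the image of `h` under most iterates of the group
automaton. -/
lemma upperDensityLE_of_pow_prime_eq_one {p : ℕ} [Fact p.Prime] {ξ : (ℤ → K) → ℂ}
    (hξ : ∀ x y, ξ (x + y) = ξ x * ξ y) {T : ℤ} {N : ℕ} {h : ℤ → K}
    (hp : ∀ t, ξ (translate t h) ^ p = 1) (hT : ∀ t, T < t → ξ (translate t h) = 1)
    (hN : ∀ t, t ≤ T - N → ξ (translate t h) = 1) (hne : ∃ t, ξ (translate t h) ≠ 1) (m : ℕ) :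
    UpperDensityLE {n | ¬ ∃ J : Finset ℤ, m ≤ J.card ∧
      ∀ t ∈ J, ξ ((CA (fun a b : K => a + b))^[n] (translate t h)) ≠ 1} 0 := by
  have hp0 : NeZero p := ⟨(Fact.out : p.Prime).ne_zero⟩
  choose e he using fun t => exists_stdAddChar_eq (hp t)
  have hinj := ZMod.injective_stdAddChar (N := p)
  have he0 : ∀ t, ξ (translate t h) = 1 ↔ e t = 0 := fun t => by
    rw [← he t, ← hinj.eq_iff (b := (0 : ZMod p)), AddChar.map_zero_eq_one]
  set P : Polynomial (ZMod p) := ∑ q ∈ Finset.range N, Polynomial.monomial q (e (T - q)) with hP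
  have hcoeff : ∀ q : ℕ, P.coeff q = e (T - q) := by
    intro q
    simp only [hP, Polynomial.finsetSum_coeff, Polynomial.coeff_monomial, Finset.sum_ite_eq',
      Finset.mem_range]
    split_ifs with hq
    · rfl
    · exact ((he0 _).1 (hN _ (by omega))).symm
  have hP0 : P ≠ 0 := by
    obtain ⟨t, ht⟩ := hne
    have htT : t ≤ T := by
      by_contra! hlt
      exact ht (hT t hlt)
    intro h0
    have := hcoeff (T - t).toNat
    rw [h0, Polynomial.coeff_zero, Int.toNat_of_nonneg (by omega), sub_sub_cancel] at this
    exact ht ((he0 t).2 this.symm)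
  have hstep : ∀ n t, ξ ((CA (fun a b : K => a + b))^[n + 1] (translate t h)) =
      ξ ((CA (fun a b : K => a + b))^[n] (translate t h)) *
        ξ ((CA (fun a b : K => a + b))^[n] (translate (t + 1) h)) := by
    intro n t
    rw [Function.iterate_succ_apply, CA_add_eq, translate_translate, CA_add_iterate_add, hξ,
      add_comm 1 t]
  have hright : ∀ n t, T < t → ξ ((CA (fun a b : K => a + b))^[n] (translate t h)) = 1 := by
    intro n
    induction n with
    | zero => exact hT
    | succ n ih =>
      intro t ht
      rw [hstep, ih t ht, ih (t + 1) (by omega), one_mul]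
  have hkey : ∀ n (q : ℕ), ξ ((CA (fun a b : K => a + b))^[n] (translate (T - q) h)) =
      ZMod.stdAddChar (((Polynomial.X + 1) ^ n * P).coeff q) := by
    intro n
    induction n with
    | zero =>
      intro q
      rw [pow_zero, one_mul, hcoeff, he]
      rfl
    | succ n ih =>
      intro q
      rw [hstep, pow_succ', mul_assoc, add_mul, one_mul, Polynomial.coeff_add, AddChar.map_add_eq_mul,
        ih, mul_comm]
      congr 1
      rcases q with _ | q
      · rw [hright _ _ (by simp), Polynomial.coeff_X_mul_zero, AddChar.map_zero_eq_one]
      · rw [Polynomial.coeff_X_mul, ← ih]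
        congr 3
        push_cast
        ring
  refine (upperDensityLE_card_support_X_add_one_pow_mul p m hP0).mono (fun n hn => ?_) le_rfl
  simp only [Set.mem_ofPred_eq] at hn ⊢
  by_contra! hcard
  refine hn ⟨((Polynomial.X + 1) ^ n * P).support.image fun q : ℕ => T - (q : ℤ), ?_, ?_⟩
  · rwa [Finset.card_image_of_injective _ fun a b hab => by simpa using hab]
  · intro t ht
    obtain ⟨q, hq, rfl⟩ := Finset.mem_image.1 ht
    rw [hkey, ← AddChar.map_zero_eq_one (ZMod.stdAddChar (N := p)), hinj.ne_iff]
    exact Polynomial.mem_support_iff.1 hq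

/-- A local character of finite order which is nontrivial on a shift-invariant set of finitely
supported configurations is nontrivial on many translates of the image of one of them under most
iterates of the group automaton. -/
lemma exists_upperDensityLE_of_ne_one {χ : (ℤ → K) → ℂ} (hχ : ∀ x y, χ (x + y) = χ x * χ y)
    {W : ℕ} (hW : DependsOn χ (Set.Icc (-(W : ℤ)) W)) {d : ℕ} (hd : 0 < d)
    (hχd : ∀ x, χ x ^ d = 1) {H : Set (ℤ → K)} (hH : ∀ x ∈ H, ∀ t, translate t x ∈ H)
    (hfin : ∀ x ∈ H, ∃ N : ℕ, ∀ i : ℤ, (N : ℤ) < |i| → x i = 0) (hne : ∃ x ∈ H, χ x ≠ 1) :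
    ∃ h ∈ H, ∃ l : ℕ, (∀ i, i ∉ Set.Ico (0 : ℤ) l → h i = 0) ∧ ∀ m : ℕ,
      UpperDensityLE {n | ¬ ∃ J : Finset ℤ, m ≤ J.card ∧
        ∀ t ∈ J, χ ((CA (fun a b : K => a + b))^[n] (translate t h)) ≠ 1} 0 := by
  classical
  have hex : ∃ N : ℕ, 0 < N ∧ ∀ x ∈ H, χ x ^ N = 1 := ⟨d, hd, fun x _ => hχd x⟩
  set N := Nat.find hex with hN
  obtain ⟨hN0, hNχ⟩ := Nat.find_spec hex
  have hN1 : N ≠ 1 := by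
    intro h1
    obtain ⟨x, hx, hχx⟩ := hne
    have := hNχ x hx
    rw [← hN, h1, pow_one] at this
    exact hχx this
  set p := N.minFac with hpdef
  have hp : p.Prime := Nat.minFac_prime hN1
  have hpf : Fact p.Prime := ⟨hp⟩
  have hpN : N / p * p = N := Nat.div_mul_cancel (Nat.minFac_dvd N)
  have hdiv0 : 0 < N / p := Nat.div_pos (Nat.le_of_dvd hN0 (Nat.minFac_dvd N)) hp.pos
  have hlt : N / p < N := Nat.div_lt_self hN0 hp.one_lt
  have hmin := Nat.find_min hex hlt
  push Not at hmin
  obtain ⟨x, hx, hχx⟩ := hmin hdiv0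
  obtain ⟨M, hM⟩ := hfin x hx
  have hχ0 : χ 0 = 1 := by
    have h0 := hχ 0 0
    rw [add_zero] at h0
    have : χ 0 ≠ 0 := fun h => by simpa [h, hd.ne'] using hχd 0
    exact (mul_right_eq_self₀.1 h0.symm).resolve_right this
  have htriv : ∀ y : ℤ → K, (∀ i ∈ Set.Icc (-(W : ℤ)) W, y i = 0) → χ y = 1 := fun y hy => by
    rw [← hχ0]
    exact hW hy
  refine ⟨translate (-M) x, hH x hx _, 2 * M + 1, fun i hi => ?_, fun m => ?_⟩
  · simp only [Set.mem_Ico, not_and_or, not_le, not_lt] at hi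
    rw [translate_apply]
    refine hM _ (lt_abs.2 ?_)
    push_cast at hi
    omega
  · have hmain := upperDensityLE_of_pow_prime_eq_one (p := p) (ξ := fun y => χ y ^ (N / p))
      (fun y z => by rw [hχ, mul_pow]) (T := 2 * M + W) (N := 2 * M + 2 * W + 1)
      (h := translate (-M) x) (fun t => by
        rw [← pow_mul, hpN]
        exact hNχ _ (hH _ (hH x hx _) t))
      (fun t ht => by
        rw [htriv, one_pow]
        intro i hi
        rw [translate_apply, translate_apply]
        refine hM _ (lt_abs.2 ?_)
        simp only [Set.mem_Icc] at hi
        omega)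
      (fun t ht => by
        rw [htriv, one_pow]
        intro i hi
        rw [translate_apply, translate_apply]
        refine hM _ (lt_abs.2 ?_)
        simp only [Set.mem_Icc] at hi
        push_cast at ht
        omega)
      ⟨M, by rwa [translate_translate, add_neg_cancel, translate_zero]⟩ m
    refine hmain.mono (fun n hn => ?_) le_rfl
    simp only [Set.mem_ofPred_eq] at hn ⊢
    rintro ⟨J, hJ, hJt⟩
    exact hn ⟨J, hJ, fun t ht h1 => hJt t ht (by rw [h1, one_pow])⟩

end Homoclinic

lemma mem_TMC_prodE {K B : Type*} {EK : Set (K × K)} {EB : Set (B × B)} {x : ℤ → K × B} :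
    x ∈ TMC (prodE EK EB) ↔ (fun i => (x i).1) ∈ TMC EK ∧ (fun i => (x i).2) ∈ TMC EB :=
  forall_and

/-- The points of the TMC of `E` that vanish outside a finite set. -/
def homoclinic {K : Type*} [Zero K] (E : Set (K × K)) : Set (ℤ → K) :=
  {x ∈ TMC E | ∃ N : ℕ, ∀ i : ℤ, (N : ℤ) < |i| → x i = 0}

lemma translate_mem_homoclinic {K : Type*} [Zero K] {E : Set (K × K)} {x : ℤ → K}
    (hx : x ∈ homoclinic E) (t : ℤ) : translate t x ∈ homoclinic E := by
  obtain ⟨hxE, N, hN⟩ := hx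
  refine ⟨translate_mem_TMC hxE t, N + t.natAbs, fun i hi => hN _ ?_⟩
  have h1 := abs_sub_abs_le_abs_sub i (-t)
  rw [abs_neg, sub_neg_eq_add] at h1
  push_cast at hi
  omega

section AddCommGroup

variable {K : Type*} [AddCommGroup K] {EK : Set (K × K)}

lemma nsmul_mem_TMC (hadd : SC EK fun a b => a + b) {x : ℤ → K} (hx : x ∈ TMC EK) (n : ℕ) :
    (n + 1) • x ∈ TMC EK := by
  induction n with
  | zero => simpa using hx
  | succ n ih =>
    rw [succ_nsmul]
    exact hadd _ ih _ hx

lemma sub_mem_TMC [Finite K] (hadd : SC EK fun a b => a + b) {x y : ℤ → K} (hx : x ∈ TMC EK)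
    (hy : y ∈ TMC EK) : x - y ∈ TMC EK := by
  have hcard : Nat.card K ≠ 0 := Nat.card_pos.ne'
  have hy' : ∀ z : K, (Nat.card K - 1 + (Nat.card K - 1) + 1) • z = -z := fun z => by
    rw [eq_neg_iff_add_eq_zero, ← succ_nsmul]
    have : Nat.card K - 1 + (Nat.card K - 1) + 1 + 1 = 2 * Nat.card K := by omega
    rw [this, mul_nsmul, card_nsmul_eq_zero']
  have h1 := hadd _ hx _ (nsmul_mem_TMC hadd hy (Nat.card K - 1 + (Nat.card K - 1)))
  convert h1 using 1
  funext i
  rw [Pi.sub_apply, Pi.smul_apply, hy', sub_eq_add_neg]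

lemma CA_add_mem_TMC (hadd : SC EK fun a b => a + b) {x : ℤ → K} (hx : x ∈ TMC EK) :
    CA (fun a b : K => a + b) x ∈ TMC EK :=
  hadd _ hx _ (translate_mem_TMC hx 1)

/-- If a character is nontrivial on homoclinic points, then the means of the functions it
controls tend to zero in density. -/
lemma GoodMeasure.upperDensityLE_of_homoclinic {A : Type*} {E : Set (A × A)} [TopologicalSpace A]
    [DiscreteTopology A] [MeasurableSpace A] [MeasurableSingletonClass A] [Finite A]
    {μ : Measure (ℤ → A)} (h : GoodMeasure E μ) (hc : CCSD E μ) {B : Type*} {EB : Set (B × B)}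
    (θ : A ≃ K × B) (hθ : ∀ x, x ∈ TMC E ↔ θ ∘ x ∈ TMC (prodE EK EB))
    (hadd : SC EK fun a b => a + b) {χ : (ℤ → K) → ℂ} (hχ : ∀ x y, χ (x + y) = χ x * χ y)
    {W : ℕ} (hW : DependsOn χ (Set.Icc (-(W : ℤ)) W)) {d : ℕ} (hd : 0 < d)
    (hχd : ∀ x, χ x ^ d = 1) (hne : ∃ x ∈ homoclinic EK, χ x ≠ 1) {u : ℕ → (ℤ → A) → ℂ}
    (hum : ∀ n, Measurable (u n)) (hu1 : ∀ n x, ‖u n x‖ ≤ 1)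
    (hu : ∀ n x y (g : ℤ → K), (∀ i, θ (y i) = ((θ (x i)).1 + g i, (θ (x i)).2)) →
      u n y = χ ((CA fun a b : K => a + b)^[n] g) * u n x) {ε : ℝ} (hε : 0 < ε) :
    UpperDensityLE {n | ε < ‖∫ x, u n x ∂μ‖} 0 := by
  obtain ⟨g, hgH, l, hgl, hdens⟩ := exists_upperDensityLE_of_ne_one hχ hW hd hχd
    (fun x hx t => translate_mem_homoclinic hx t) (fun x hx => hx.2) hne
  set π : ℤ → Equiv.Perm A := fun i =>
    (θ.trans ((Equiv.addRight (g i)).prodCongr (Equiv.refl B))).trans θ.symm with hπ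
  have hθπ : ∀ i a, θ (π i a) = ((θ a).1 + g i, (θ a).2) := fun i a => θ.apply_symm_apply _
  have hπE : ∀ x ∈ TMC E, letterwise π x ∈ TMC E := by
    intro x hx
    rw [hθ, mem_TMC_prodE] at hx ⊢
    simp only [Function.comp, letterwise_apply, hθπ]
    exact ⟨hadd _ hx.1 _ hgH.1, hx.2⟩
  have hπ1 : ∀ i, i ∉ Set.Ico (0 : ℤ) l → π i = 1 := fun i hi => by
    ext a
    apply θ.injective
    rw [hθπ, hgl i hi, add_zero]
    rfl
  obtain ⟨m₀, hm₀⟩ := h.decoupling hc hπE hπ1 hd hε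
  refine (hdens m₀).mono (fun n hn => ?_) le_rfl
  simp only [Set.mem_ofPred_eq] at hn ⊢
  rintro ⟨J, hJ, hJχ⟩
  refine absurd (hm₀ (J.image Neg.neg) (by rwa [Finset.card_image_of_injective _ neg_injective])
    (u n) (hum n) (hu1 n) (fun t => χ ((CA fun a b : K => a + b)^[n] (translate (-t) g)))
    (fun t ht => ⟨hχd _, ?_⟩) (fun t _ x => hu n x _ _ fun i => ?_)) (not_le.2 hn)
  · obtain ⟨t, htJ, rfl⟩ := Finset.mem_image.1 ht
    rw [neg_neg]
    exact hJχ t htJ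
  · simp [hθπ]

end AddCommGroup

section RegularSimple

/-- The inverse of an injective letter code on a TMC over a finite alphabet is a block code. -/
lemma exists_window_of_injOn {K L : Type*} [Finite K] {EK : Set (K × K)} {θ : K → L}
    (hinj : Set.InjOn (fun x : ℤ → K => θ ∘ x) (TMC EK)) :
    ∃ R : ℕ, ∀ x ∈ TMC EK, ∀ y ∈ TMC EK, ∀ j : ℤ,
      (∀ i ∈ Set.Icc (j - R) (j + R), θ (x i) = θ (y i)) → x j = y j := by
  let _ : TopologicalSpace K := ⊥
  have : DiscreteTopology K := ⟨rfl⟩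
  suffices hmain : ∃ R : ℕ, ∀ x ∈ TMC EK, ∀ y ∈ TMC EK,
      (∀ i ∈ Set.Icc (-(R : ℤ)) R, θ (x i) = θ (y i)) → x 0 = y 0 by
    obtain ⟨R, hR⟩ := hmain
    refine ⟨R, fun x hx y hy j hj => ?_⟩
    have := hR _ (translate_mem_TMC hx j) _ (translate_mem_TMC hy j) fun i hi => by
      simp only [translate_apply]
      refine hj _ ?_
      simp only [Set.mem_Icc] at hi ⊢
      omega
    simpa using this
  by_contra! hcon
  have hclosed : ∀ (P : K → K → K → K → Prop) (i j : ℤ),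
      IsClosed {p : (ℤ → K) × (ℤ → K) | P (p.1 i) (p.1 j) (p.2 i) (p.2 j)} := by
    intro P i j
    have hcont : Continuous fun p : (ℤ → K) × (ℤ → K) => (p.1 i, p.1 j, p.2 i, p.2 j) := by fun_prop
    exact (isClosed_discrete {q : K × K × K × K | P q.1 q.2.1 q.2.2.1 q.2.2.2}).preimage hcont
  set C : ℕ → Set ((ℤ → K) × (ℤ → K)) := fun R =>
    {p | ∀ i : ℤ, (p.1 i, p.1 (i + 1)) ∈ EK ∧ (p.2 i, p.2 (i + 1)) ∈ EK} ∩
      {p | ∀ i ∈ Set.Icc (-(R : ℤ)) R, θ (p.1 i) = θ (p.2 i)} ∩ {p | p.1 0 ≠ p.2 0} with hC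
  have hCc : ∀ R, IsClosed (C R) := by
    intro R
    refine (IsClosed.inter ?_ ?_).inter (hclosed (fun a _ b _ => a ≠ b) 0 0)
    · rw [Set.ofPred_forall]
      exact isClosed_iInter fun i => hclosed (fun a b c d => (a, b) ∈ EK ∧ (c, d) ∈ EK) i (i + 1)
    · simp only [Set.ofPred_forall]
      exact isClosed_iInter fun i => isClosed_iInter fun _ =>
        hclosed (fun a _ b _ => θ a = θ b) i i
  obtain ⟨⟨x, y⟩, hxy⟩ := IsCompact.nonempty_iInter_of_sequence_nonempty_isCompact_isClosed C
    (fun R p hp => ⟨⟨hp.1.1, fun i hi => hp.1.2 i ⟨by push_cast; linarith [hi.1],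
      by push_cast; linarith [hi.2]⟩⟩, hp.2⟩)
    (fun R => by
      obtain ⟨x, hx, y, hy, hxy, h0⟩ := hcon R
      exact ⟨(x, y), ⟨fun i => ⟨hx i, hy i⟩, hxy⟩, h0⟩)
    (hCc 0).isCompact hCc
  rw [Set.mem_iInter] at hxy
  refine (hxy 0).2 (congrFun (hinj (fun i => ((hxy 0).1.1 i).1) (fun i => ((hxy 0).1.1 i).2) ?_) 0)
  funext i
  exact (hxy i.natAbs).1.2 i ⟨by simp only [Int.natCast_natAbs]; exact neg_abs_le i,
    by simp only [Int.natCast_natAbs]; exact le_abs_self i⟩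

lemma fst_apply_of_mem_hTMC {F : Type*} {τ : Equiv.Perm F} {n : ℕ} {x : ℤ → F × Fin n}
    (hx : x ∈ hTMC τ n) (i : ℤ) : (x i).1 = (τ ^ i) (x 0).1 := by
  induction i using Int.induction_on with
  | zero => rfl
  | succ i ih =>
    rw [add_comm (i : ℤ) 1, zpow_add, zpow_one, Equiv.Perm.mul_apply, ← ih, add_comm 1 (i : ℤ)]
    exact hx i
  | pred i ih =>
    have h1 : (x (-(i : ℤ) - 1 + 1)).1 = τ (x (-(i : ℤ) - 1)).1 := hx (-(i : ℤ) - 1)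
    rw [sub_add_cancel, ih] at h1
    apply τ.injective
    rw [← h1, ← Equiv.Perm.mul_apply, ← zpow_one_add]
    congr 2
    ring

/-- A local character that is trivial on homoclinic points factors through the finite factor of a
regular and simple group automaton. -/
lemma eq_of_fst_eq_of_trivial_on_homoclinic {K F : Type*} [AddCommGroup K] [Finite K]
    {EK : Set (K × K)} (hadd : SC EK fun a b => a + b) {τ : Equiv.Perm F} {n : ℕ}
    {θ : K → F × Fin n} (hθ : Set.BijOn (fun x => θ ∘ x) (TMC EK) (hTMC τ n))
    {χ : (ℤ → K) → ℂ} (hχ : ∀ x y, χ (x + y) = χ x * χ y)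
    {W : ℕ} (hW : DependsOn χ (Set.Icc (-(W : ℤ)) W)) (htriv : ∀ x ∈ homoclinic EK, χ x = 1)
    {x y : ℤ → K} (hx : x ∈ TMC EK) (hy : y ∈ TMC EK) (hxy : (θ (x 0)).1 = (θ (y 0)).1) :
    χ x = χ y := by
  obtain ⟨R, hR⟩ := exists_window_of_injOn hθ.injOn
  have hfst : ∀ i, (θ (x i)).1 = (θ (y i)).1 := fun i => by
    have h1 := fst_apply_of_mem_hTMC (hθ.mapsTo hx) i
    have h2 := fst_apply_of_mem_hTMC (hθ.mapsTo hy) i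
    simp only [Function.comp] at h1 h2
    rw [h1, h2, hxy]
  set w : ℤ → F × Fin n := fun i => if |i| ≤ W + R then θ (y i) else θ (x i) with hw
  have hwfst : ∀ i, (w i).1 = (θ (x i)).1 := fun i => by
    simp only [hw]
    split_ifs
    · exact (hfst i).symm
    · rfl
  have hwT : w ∈ hTMC τ n := fun i => by
    simp only [Set.mem_ofPred_eq, hwfst]
    exact hθ.mapsTo hx i
  obtain ⟨z, hz, hzw⟩ := hθ.surjOn hwT
  have hzw' : ∀ i, θ (z i) = w i := fun i => congrFun hzw i
  have hzy : χ z = χ y := hW fun j hj => hR z hz y hy j fun i hi => by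
    rw [hzw', hw]
    refine if_pos (abs_le.2 ?_)
    simp only [Set.mem_Icc] at hi hj
    omega
  have hzx : z - x ∈ homoclinic EK := by
    refine ⟨sub_mem_TMC hadd hz hx, W + R + R, fun j hj => ?_⟩
    rw [Pi.sub_apply, sub_eq_zero]
    refine hR z hz x hx j fun i hi => ?_
    rw [hzw', hw]
    refine if_neg (not_le.2 (lt_abs.2 ?_))
    simp only [Set.mem_Icc] at hi
    push_cast at hj
    rcases lt_abs.1 hj with h | h <;> omega
  rw [← hzy, ← sub_add_cancel z x, hχ, htriv _ hzx, one_mul]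

lemma RegularSimpleData.fst_CA {K F : Type*} {EK : Set (K × K)} {φK : K → K → K}
    {τ : Equiv.Perm F} {n k : ℕ} {op : (ℤ → F × Fin n) → (ℤ → F × Fin n) → (ℤ → F × Fin n)}
    {θ : K → F × Fin n} {oF : F → F → F} {oS : Fin n → Fin n → Fin n}
    (h : RegularSimpleData EK φK τ n k op θ oF oS) {x : ℤ → K} (hx : x ∈ TMC EK) :
    (θ (CA φK x 0)).1 = oF (θ (x 0)).1 (τ (θ (x 0)).1) := by
  obtain ⟨-, -, -, -, ⟨hbij, hconj⟩, -, -, hop⟩ := h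
  have hxT := hbij.mapsTo hx
  have h1 : θ ∘ x = ident τ (θ (x 0)).1 fun i => (θ (x i)).2 := by
    funext i
    exact Prod.ext (fst_apply_of_mem_hTMC hxT i) rfl
  have h2 : shiftMap (θ ∘ x) = ident τ (τ (θ (x 0)).1) fun i => (θ (x (i + 1))).2 := by
    funext i
    refine Prod.ext ?_ rfl
    refine (fst_apply_of_mem_hTMC hxT (i + 1)).trans ?_
    rw [zpow_add, zpow_one]
    rfl
  have h3 := congrFun (hconj x hx) 0
  simp only at h3
  rw [h2, h1, hop] at h3
  simpa [ident] using congrArg Prod.fst h3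

end RegularSimple

lemma CA_iterate_congr {K : Type*} (φ : K → K → K) {x y : ℤ → K} {a b : ℤ} (n : ℕ)
    (h : ∀ i ∈ Set.Icc a (b + n), x i = y i) :
    ∀ i ∈ Set.Icc a b, (CA φ)^[n] x i = (CA φ)^[n] y i := by
  induction n generalizing x y with
  | zero => simpa using h
  | succ n ih =>
    rw [Function.iterate_succ_apply, Function.iterate_succ_apply]
    refine ih fun i hi => ?_
    simp only [Set.mem_Icc, CA] at hi h ⊢
    push_cast at h
    rw [h i ⟨by omega, by omega⟩, h (i + 1) ⟨by omega, by omega⟩]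

lemma CA_prod_iterate {K B : Type*} (add : K → K → K) (s : Equiv.Perm B) (n : ℕ)
    (y : ℤ → K × B) (i : ℤ) :
    (CA (fun p q : K × B => (add p.1 q.1, s q.2)))^[n] y i =
      ((CA add)^[n] (fun j => (y j).1) i, (s ^ n) (y (i + n)).2) := by
  induction n generalizing y i with
  | zero => simp
  | succ n ih =>
    rw [Function.iterate_succ_apply, ih, Function.iterate_succ_apply]
    refine Prod.ext rfl ?_
    simp only [CA, pow_succ, Equiv.Perm.mul_apply]
    push_cast
    rw [add_assoc]

section Means

variable {A : Type*} {E : Set (A × A)} [TopologicalSpace A] [DiscreteTopology A]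
  [MeasurableSpace A] [MeasurableSingletonClass A] [Finite A] {μ : Measure (ℤ → A)}

/-- Means of functions that factor through a finite factor are Cesàro convergent. -/
lemma GoodMeasure.cesaroConv_of_factor (h : GoodMeasure E μ) {K B F : Type*} [Finite F] [Finite B]
    {EK : Set (K × K)} {θ : A → K × B} (hθ : ∀ x ∈ TMC E, (fun i => (θ (x i)).1) ∈ TMC EK)
    {f : K → F} {τ : Equiv.Perm F} {D : F → F} {φ : K → K → K}
    (hτ : ∀ x ∈ TMC EK, ∀ i, f (x (i + 1)) = τ (f (x i)))
    (hφ : ∀ x ∈ TMC EK, CA φ x ∈ TMC EK) (hD : ∀ x ∈ TMC EK, f (CA φ x 0) = D (f (x 0)))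
    {χ : (ℤ → K) → ℂ} (hχ : ∀ x ∈ TMC EK, ∀ y ∈ TMC EK, f (x 0) = f (y 0) → χ x = χ y)
    {g : (ℤ → B) → ℂ} {W : ℕ} (hg : DependsOn g (Set.Icc (-(W : ℤ)) W)) (s : Equiv.Perm B) :
    CesaroConv fun n => ∫ x, χ ((CA φ)^[n] fun i => (θ (x i)).1) *
      g (fun i => (s ^ n) (θ (x (i + n))).2) ∂μ := by
  have hχc : ∃ c : F → ℂ, ∀ x ∈ TMC EK, χ x = c (f (x 0)) := by
    classical
    refine ⟨fun a => if hx : ∃ x ∈ TMC EK, f (x 0) = a then χ hx.choose else 0, fun x hx => ?_⟩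
    have hex : ∃ y ∈ TMC EK, f (y 0) = f (x 0) := ⟨x, hx, rfl⟩
    simp only [dif_pos hex]
    exact hχ x hx _ hex.choose_spec.1 hex.choose_spec.2.symm
  obtain ⟨c, hc⟩ := hχc
  have hiter : ∀ n, ∀ x ∈ TMC EK, (CA φ)^[n] x ∈ TMC EK ∧
      f ((CA φ)^[n] x 0) = D^[n] (f (x 0)) := by
    intro n
    induction n with
    | zero => exact fun x hx => ⟨hx, rfl⟩
    | succ n ih =>
      intro x hx
      obtain ⟨h1, h2⟩ := ih x hx
      simp only [Function.iterate_succ_apply']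
      exact ⟨hφ _ h1, by rw [hD _ h1, h2]⟩
  have hback : ∀ n : ℕ, ∀ x ∈ TMC EK, f (x (-(n : ℤ))) = τ.symm^[n] (f (x 0)) := by
    intro n x hx
    induction n with
    | zero => rfl
    | succ n ih =>
      rw [Function.iterate_succ_apply', ← ih, Equiv.eq_symm_apply, ← hτ x hx]
      congr 2
      push_cast
      ring
  have hmeas : ∀ n : ℕ, Measurable fun x : ℤ → A => c (D^[n] (f (θ (x 0)).1)) *
      g (fun i => (s ^ n) (θ (x (i + n))).2) := by
    intro n
    refine measurable_of_dependsOn (s := {0} ∪ Set.Icc (-(W : ℤ) + n) (W + n))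
      ((Set.finite_singleton _).union (Set.finite_Icc _ _)) fun x y hxy => ?_
    have h0 : x 0 = y 0 := hxy 0 (Or.inl rfl)
    have h1 : g (fun i => (s ^ n) (θ (x (i + n))).2) = g (fun i => (s ^ n) (θ (y (i + n))).2) :=
      hg fun i hi => by
        rw [hxy (i + n) (Or.inr ⟨by linarith [hi.1], by linarith [hi.2]⟩)]
    simp only [h0, h1]
  have hintg : ∀ n : ℕ, ∫ x, χ ((CA φ)^[n] fun i => (θ (x i)).1) *
      g (fun i => (s ^ n) (θ (x (i + n))).2) ∂μ =
      ∫ x, c (D^[n] (τ.symm^[n] (f (θ (x 0)).1))) * g (fun i => (s ^ n) (θ (x i)).2) ∂μ := by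
    intro n
    have h1 : ∫ x, χ ((CA φ)^[n] fun i => (θ (x i)).1) *
        g (fun i => (s ^ n) (θ (x (i + n))).2) ∂μ =
        ∫ x, c (D^[n] (f (θ (x 0)).1)) * g (fun i => (s ^ n) (θ (x (i + n))).2) ∂μ := by
      refine integral_congr_ae (h.ae_mem.mono fun x hx => ?_)
      obtain ⟨h2, h3⟩ := hiter n _ (hθ x hx)
      simp only
      rw [hc _ h2, h3]
    rw [h1, ← integral_comp_translate h.2.1 (hmeas n).aestronglyMeasurable (-(n : ℤ))]
    refine integral_congr_ae (h.ae_mem.mono fun x hx => ?_)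
    have h4 := hback n _ (hθ x hx)
    simp only [translate_apply, zero_add, add_neg_cancel_right] at h4 ⊢
    rw [h4]
  simp only [hintg]
  have horbit := CesaroConv.of_finite_orbit
    (S := (F → F) × (F → F) × Equiv.Perm B)
    (fun q => (D ∘ q.1, τ.symm ∘ q.2.1, s * q.2.2)) (id, id, 1)
    (fun q => ∫ x, c (q.1 (q.2.1 (f (θ (x 0)).1))) * g (fun i => q.2.2 (θ (x i)).2) ∂μ)
  have hstep : ∀ n, (fun q : (F → F) × (F → F) × Equiv.Perm B =>
      (D ∘ q.1, τ.symm ∘ q.2.1, s * q.2.2))^[n] (id, id, 1) = (D^[n], τ.symm^[n], s ^ n) := by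
    intro n
    induction n with
    | zero => rfl
    | succ n ih =>
      rw [Function.iterate_succ_apply', ih, Function.iterate_succ', Function.iterate_succ',
        pow_succ']
  simpa only [hstep] using horbit

/-- Means of a product of a character of the group part and a local function of the translation
part are Cesàro convergent. -/
lemma GoodMeasure.cesaroConv_character (h : GoodMeasure E μ) (hc : CCSD E μ) {K B : Type*}
    [AddCommGroup K] [Finite K] [Finite B] {EK : Set (K × K)} {EB : Set (B × B)}
    (θ : A ≃ K × B) (hθ : ∀ x, x ∈ TMC E ↔ θ ∘ x ∈ TMC (prodE EK EB))
    (hadd : SC EK fun a b => a + b) (hRS : RegularSimple EK fun a b : K => a + b)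
    (s : Equiv.Perm B) {W : ℕ} (ψ : AddChar (Set.Icc (-(W : ℤ)) W → K) ℂ)
    {g : (ℤ → B) → ℂ} (hg : DependsOn g (Set.Icc (-(W : ℤ)) W)) (hg1 : ∀ y, ‖g y‖ ≤ 1) :
    CesaroConv fun n => ∫ x, ψ (fun i => (CA fun a b : K => a + b)^[n] (fun i => (θ (x i)).1) i) *
      g (fun i => (s ^ n) (θ (x (i + n))).2) ∂μ := by
  have := h.1
  set χ : (ℤ → K) → ℂ := fun x => ψ fun i => x i with hχdef
  have hχ : ∀ x y, χ (x + y) = χ x * χ y := fun x y => ψ.map_add_eq_mul _ _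
  have hW : DependsOn χ (Set.Icc (-(W : ℤ)) W) := fun x y hxy => by
    simp only [hχdef]
    congr 1
    funext i
    exact hxy i i.2
  have hd : 0 < Nat.card K := Nat.card_pos
  have hχd : ∀ x, χ x ^ Nat.card K = 1 := fun x => by
    simp only [hχdef]
    rw [← AddChar.map_nsmul_eq_pow, ← ψ.map_zero_eq_one]
    congr 1
    funext i
    exact card_nsmul_eq_zero'
  have hχ1 : ∀ x, ‖χ x‖ = 1 := fun x => Complex.norm_eq_one_of_pow_eq_one (hχd x) hd.ne'
  by_cases htriv : ∀ x ∈ homoclinic EK, χ x = 1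
  · obtain ⟨F, hF, τ, n, k, op, θ', oF, oS, hdata⟩ := hRS
    have hbij := hdata.2.2.2.2.1.1
    exact h.cesaroConv_of_factor (φ := fun a b : K => a + b) (EK := EK) (θ := θ)
      (f := fun a => (θ' a).1) (τ := τ) (D := fun a => oF a (τ a)) (χ := χ) (W := W)
      (fun x hx => (mem_TMC_prodE.1 ((hθ x).1 hx)).1)
      (fun x hx i => hbij.mapsTo hx i) (fun x hx => CA_add_mem_TMC hadd hx)
      (fun x hx => hdata.fst_CA hx)
      (fun x hx y hy hxy => eq_of_fst_eq_of_trivial_on_homoclinic hadd hbij hχ hW htriv hx hy hxy)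
      hg s
  · push Not at htriv
    set u : ℕ → (ℤ → A) → ℂ := fun n x => χ ((CA fun a b : K => a + b)^[n] fun i => (θ (x i)).1) *
      g (fun i => (s ^ n) (θ (x (i + n))).2) with hu
    have hum : ∀ n, Measurable (u n) := by
      intro n
      refine measurable_of_dependsOn (Set.finite_Icc (-(W : ℤ)) (W + n)) fun x y hxy => ?_
      simp only [hu]
      congr 1
      · exact hW fun i hi => CA_iterate_congr _ n (fun j hj => by rw [hxy j hj]) i hi
      · exact hg fun i hi => by rw [hxy (i + n) ⟨by linarith [hi.1], by linarith [hi.2]⟩]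
    have hu1 : ∀ n x, ‖u n x‖ ≤ 1 := fun n x => by
      simp only [hu]
      rw [norm_mul, hχ1, one_mul]
      exact hg1 _
    refine CesaroConv.of_upperDensityLE (M := 1) (fun n => ?_) fun ε hε =>
      h.upperDensityLE_of_homoclinic hc θ hθ hadd hχ hW hd hχd htriv hum hu1 ?_ hε
    · exact (norm_integral_le_of_norm_le_const (ae_of_all _ (hu1 n))).trans (by simp)
    · intro n x y z hxy
      simp only [hu, hxy]
      rw [← mul_assoc, mul_comm (χ _) (χ _), ← hχ, ← CA_add_iterate_add]
      rfl

end Means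

/-- The abelian group structure of an abelian group operation. -/
lemma IsAbelianGroupOp.exists_addCommGroup {K : Type*} {add : K → K → K}
    (h : IsAbelianGroupOp add) : ∃ _ : AddCommGroup K, add = fun a b => a + b := by
  obtain ⟨hassoc, hcomm, z, hz, hinv⟩ := h
  choose neg hneg using hinv
  let _ : Add K := ⟨add⟩
  let _ : Zero K := ⟨z⟩
  let _ : Neg K := ⟨neg⟩
  exact ⟨{ add_assoc := hassoc
           zero_add := hz
           add_zero := fun a => (hcomm a z).trans (hz a)
           nsmul := nsmulRec
           zsmul := zsmulRec
           neg_add_cancel := fun a => (hcomm _ a).trans (hneg a)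
           add_comm := hcomm }, rfl⟩

/-- A function on `X × Y`, with `X` a finite abelian group, is a combination of products of
characters of `X` and indicators of points of `Y`. -/
lemma exists_sum_addChar_mul_ite {X Y : Type*} [AddCommGroup X] [Finite X] [Fintype Y]
    [DecidableEq Y] [Fintype (AddChar X ℂ)] (f : X → Y → ℂ) :
    ∃ c : AddChar X ℂ × Y → ℂ, ∀ a b,
      f a b = ∑ q, c q * (q.1 a * if b = q.2 then 1 else 0) := by
  refine ⟨fun q => (AddChar.complexBasis X).repr (fun a => f a q.2) q.1, fun a b => ?_⟩
  rw [Fintype.sum_prod_type]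
  simp only [mul_ite, mul_one, mul_zero, Finset.sum_ite_eq, Finset.mem_univ, if_true]
  have h := congrFun ((AddChar.complexBasis X).sum_repr fun a => f a b) a
  simp only [Finset.sum_apply, Pi.smul_apply, smul_eq_mul, AddChar.complexBasis_apply] at h
  exact h.symm

lemma continuous_CA {G : Type*} [TopologicalSpace G] [DiscreteTopology G] (φ : G → G → G) :
    Continuous (CA φ) :=
  continuous_pi fun j => Continuous.comp (g := fun p : G × G => φ p.1 p.2)
    (f := fun x : ℤ → G => (x j, x (j + 1))) continuous_of_discreteTopology ((continuous_apply j).prodMk (continuous_apply (j + 1)))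

end CAStmt

/-- Theorem (ii): Cesàro mean convergence for SC right-permutative
Ψ-associative c.a. whose associated group c.a. is abelian, regular and simple. -/
theorem CAStmt.stmt16 {G K B : Type} [Fintype G] [Fintype K] [Fintype B]
    [TopologicalSpace G] [DiscreteTopology G]
    [MeasurableSpace G] [MeasurableSingletonClass G]
    (E : Set (G × G)) (hE : EveryLetterOccurs E)
    (φ : G → G → G) (hSC : SC E φ) (hR : RightPerm φ)
    (Ψ : Equiv.Perm G) (hΨ : ∀ a b c : G, φ (φ a b) c = Ψ (φ a (φ b c)))
    (add : K → K → K) (hab : IsAbelianGroupOp add)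
    (s : Equiv.Perm B)
    (EK : Set (K × K)) (EB : Set (B × B))
    (hEK : EveryLetterOccurs EK) (hEB : EveryLetterOccurs EB)
    (θ : G → K × B) (hθ : Function.Bijective θ)
    (hconj : OneBlockConjugacy (TMC E) (CA φ)
      (TMC (prodE EK EB)) (CA (fun p q : K × B => (add p.1 q.1, s q.2))) θ)
    (hSCK : SC EK add) (hbiK : RightPerm add ∧ LeftPerm add)
    (hRS : RegularSimple EK add)
    (μ : Measure (ℤ → G)) (hgood : GoodMeasure E μ) (hccsd : CCSD E μ) :
    ∃ κ : Measure (ℤ → G), IsProbabilityMeasure κ ∧ CesaroTendstoTo μ (CA φ) κ := by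
  classical
  have := hgood.1
  obtain ⟨hK, rfl⟩ := hab.exists_addCommGroup
  set e : G ≃ K × B := Equiv.ofBijective θ hθ with he
  obtain ⟨hbij, hcomm⟩ := hconj
  have heE : ∀ x, x ∈ TMC E ↔ e ∘ x ∈ TMC (prodE EK EB) := by
    refine fun x => ⟨fun hx => hbij.mapsTo hx, fun hx => ?_⟩
    obtain ⟨y, hy, hyx⟩ := hbij.surjOn hx
    have hxy : y = x := hθ.1.comp_left hyx
    rwa [← hxy]
  have hiter : ∀ n, ∀ x ∈ TMC E, (CA φ)^[n] x ∈ TMC E ∧ e ∘ ((CA φ)^[n] x) =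
      (CA fun p q : K × B => (p.1 + q.1, s q.2))^[n] (e ∘ x) := by
    intro n
    induction n with
    | zero => exact fun x hx => ⟨hx, rfl⟩
    | succ n ih =>
      intro x hx
      obtain ⟨h1, h2⟩ := ih x hx
      simp only [Function.iterate_succ_apply']
      exact ⟨hSC _ h1 _ (translate_mem_TMC h1 1), by rw [← h2]; exact hcomm _ h1⟩
  refine exists_cesaroTendstoTo (continuous_CA φ) fun f W hf => ?_
  have h0 : (0 : ℤ) ∈ Set.Icc (-(W : ℤ)) W := ⟨by omega, by omega⟩
  have : Fintype (AddChar (Set.Icc (-(W : ℤ)) W → K) ℂ) := Fintype.ofFinite _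
  obtain ⟨c, hcsum⟩ := exists_sum_addChar_mul_ite
    fun (a : Set.Icc (-(W : ℤ)) W → K) (b : Set.Icc (-(W : ℤ)) W → B) =>
      (f (fun i => if hi : i ∈ Set.Icc (-(W : ℤ)) W then e.symm (a ⟨i, hi⟩, b ⟨i, hi⟩)
        else e.symm (a ⟨0, h0⟩, b ⟨0, h0⟩)) : ℂ)
  set g : (Set.Icc (-(W : ℤ)) W → B) → (ℤ → B) → ℂ := fun b y =>
    if (fun i : Set.Icc (-(W : ℤ)) W => y i) = b then 1 else 0 with hg
  set v : AddChar (Set.Icc (-(W : ℤ)) W → K) ℂ × (Set.Icc (-(W : ℤ)) W → B) → ℕ →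
      (ℤ → G) → ℂ := fun q n x =>
    q.1 (fun i => (CA fun a b : K => a + b)^[n] (fun i => (e (x i)).1) i) *
      g q.2 (fun i => (s ^ n) (e (x (i + n))).2) with hv
  have hgW : ∀ b, DependsOn (g b) (Set.Icc (-(W : ℤ)) W) := fun b x y hxy => by
    have : (fun i : Set.Icc (-(W : ℤ)) W => x i) = fun i : Set.Icc (-(W : ℤ)) W => y i :=
      funext fun i => hxy i i.2
    simp only [hg, this]
  have hvint : ∀ q n, Integrable (v q n) μ := fun q n =>
    integrable_of_dependsOn (Set.finite_Icc (-(W : ℤ)) (W + n)) fun x y hxy => by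
      simp only [hv]
      congr 1
      · congr 1
        funext i
        exact CA_iterate_congr _ n (fun j hj => by rw [hxy j hj]) i i.2
      · refine hgW q.2 (x := fun i => (s ^ n) (e (x (i + n))).2)
          (y := fun i => (s ^ n) (e (y (i + n))).2) fun i hi => ?_
        simp only
        rw [hxy (i + n) ⟨by linarith [hi.1], by linarith [hi.2]⟩]
  have hfv : ∀ n, ∫ x, (f ((CA φ)^[n] x) : ℂ) ∂μ = ∑ q, c q * ∫ x, v q n x ∂μ := by
    intro n
    simp only [← integral_const_mul]
    rw [← integral_finsetSum _ fun q _ => (hvint q n).const_mul _]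
    refine integral_congr_ae (hgood.ae_mem.mono fun x hx => ?_)
    have h1 : ∀ i, e ((CA φ)^[n] x i) = ((CA fun a b : K => a + b)^[n] (fun i => (e (x i)).1) i,
        (s ^ n) (e (x (i + n))).2) := fun i =>
      (congrFun (hiter n x hx).2 i).trans (CA_prod_iterate _ s n _ i)
    have h2 := hcsum (fun i => (CA fun a b : K => a + b)^[n] (fun i => (e (x i)).1) i)
      fun i => (s ^ n) (e (x (i + n))).2
    simp only [hv, hg]
    rw [← h2]
    congr 1
    refine hf fun i hi => ?_
    rw [dif_pos hi, ← h1, e.symm_apply_apply]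
  simp only [hfv]
  refine CesaroConv.sum_smul _ _ fun q _ => ?_
  refine hgood.cesaroConv_character hccsd e heE hSCK hRS s q.1 (hgW q.2) fun y => ?_
  simp only [hg]
  split_ifs <;> simp
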